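/- Let 𝔤 be a simple Lie algebra over the complex numbers. Let V_1, …, V_m and W_1, …, W_n be nontrivial, irreducible, finite-dimensional 𝔤-modules. If the tensor product V_1 ⊗ ⋯ ⊗ V_m is isomorphic to W_1 ⊗ ⋯ ⊗ W_n as 𝔤-modules, then m = n and there exists a permutation σ of {1, …, n} such that V_i is isomorphic to W_{σ(i)} as 𝔤-modules for every i. -/

import Mathlib

/-- A bundled Lie module over a Lie algebra `𝔤` over `ℂ`: a complex vector space together with
a Lie algebra action of `𝔤`. -/
structure LieModuleBundle (𝔤 : Type) [LieRing 𝔤] [LieAlgebra ℂ 𝔤] : Type 1 where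
  carrier : Type
  [addCommGroup : AddCommGroup carrier]
  [module : Module ℂ carrier]
  [lieRingModule : LieRingModule 𝔤 carrier]
  [lieModule : LieModule ℂ 𝔤 carrier]

attribute [instance] LieModuleBundle.addCommGroup LieModuleBundle.module
  LieModuleBundle.lieRingModule LieModuleBundle.lieModule

/-- The tensor product (over `ℂ`) of two Lie modules, with `𝔤` acting by the Leibniz rule
`x · (v ⊗ w) = (x · v) ⊗ w + v ⊗ (x · w)`. -/
noncomputable def LieModuleBundle.tensor {𝔤 : Type} [LieRing 𝔤] [LieAlgebra ℂ 𝔤]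
    (A B : LieModuleBundle 𝔤) : LieModuleBundle 𝔤 where
  carrier := TensorProduct ℂ A.carrier B.carrier

/-- The iterated tensor product `V 0 ⊗ V 1 ⊗ ⋯ ⊗ V m` of a family of `m + 1` Lie modules. -/
noncomputable def tensorFamily {𝔤 : Type} [LieRing 𝔤] [LieAlgebra ℂ 𝔤] :
    (m : ℕ) → (Fin (m + 1) → LieModuleBundle 𝔤) → LieModuleBundle 𝔤
  | 0, V => V 0
  | m + 1, V => (tensorFamily m fun i => V i.castSucc).tensor (V (Fin.last (m + 1)))


namespace RajanAux

set_option linter.unusedSectionVars false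

section Comb

variable {ι : Type} [Fintype ι] [DecidableEq ι] (adj : ι → ι → Prop) 

/-- independent sets -/
def Indep (S : Finset ι) : Prop := ∀ i ∈ S, ∀ j ∈ S, ¬ adj i j

open Classical in
/-- signed indicator of independent sets -/
noncomputable def sgnInd (S : Finset ι) : ℝ := if Indep adj S then (-1) ^ S.card else 0

/-- convolution of set functions -/
noncomputable def conv (F G : Finset ι → ℝ) (S : Finset ι) : ℝ :=
  ∑ J ∈ S.powerset, F J * G (S \ J)

lemma sgnInd_empty : sgnInd adj (∅ : Finset ι) = 1 := by
  simp [sgnInd, Indep]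

lemma conv_eq_add (G : Finset ι → ℝ) (S : Finset ι) :
    conv (sgnInd adj) G S = G S + ∑ J ∈ S.powerset.erase ∅, sgnInd adj J * G (S \ J) := by
  unfold conv
  rw [← Finset.add_sum_erase _ _ (Finset.empty_mem_powerset S), sgnInd_empty]
  simp

lemma conv_unique {G G' : Finset ι → ℝ}
    (h : ∀ S, conv (sgnInd adj) G S = conv (sgnInd adj) G' S) (S : Finset ι) : G S = G' S := by
  induction S using Finset.strongInduction with
  | H S ih =>
    have := h S
    rw [conv_eq_add, conv_eq_add] at this
    have h2 : ∑ J ∈ S.powerset.erase ∅, sgnInd adj J * G (S \ J)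
        = ∑ J ∈ S.powerset.erase ∅, sgnInd adj J * G' (S \ J) := by
      refine Finset.sum_congr rfl fun J hJ => ?_
      simp only [Finset.mem_erase, Finset.mem_powerset] at hJ
      rw [ih]
      refine Finset.ssubset_iff_subset_ne.mpr ⟨Finset.sdiff_subset, fun h => hJ.1 ?_⟩
      rw [Finset.sdiff_eq_self_iff_disjoint] at h
      exact Finset.subset_empty.mp (h hJ.2 (le_refl _))
    linarith

/-- right-hand side -/
noncomputable def rhsB (B S : Finset ι) : ℝ := if Disjoint S B then sgnInd adj S else 0

/-- the quotient `I(G - B) / I(G)` -/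
noncomputable def rB (B : Finset ι) : Finset ι → ℝ :=
  fun S => rhsB adj B S - ∑ J ∈ (S.powerset.erase ∅).attach, sgnInd adj J.1 * rB B (S \ J.1)
termination_by S => S.card
decreasing_by
  have hJ := J.2
  simp only [Finset.mem_erase, Finset.mem_powerset] at hJ
  apply Finset.card_lt_card
  refine Finset.ssubset_iff_subset_ne.mpr ⟨Finset.sdiff_subset, fun h => hJ.1 ?_⟩
  rw [Finset.sdiff_eq_self_iff_disjoint] at h
  exact Finset.subset_empty.mp (h hJ.2 (le_refl _))

lemma conv_rB (B S : Finset ι) : conv (sgnInd adj) (rB adj B) S = rhsB adj B S := by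
  rw [conv_eq_add, rB, Finset.sum_attach (S.powerset.erase ∅)
    (fun J => sgnInd adj J * rB adj B (S \ J))]
  ring

lemma rB_emptyS (B : Finset ι) : rB adj B ∅ = 1 := by
  have := conv_rB adj B ∅
  simpa [conv, rhsB, sgnInd_empty] using this

lemma conv_shift (u : ι) (G : Finset ι → ℝ) (S : Finset ι) :
    conv (sgnInd adj) (fun S => if u ∈ S then G (S.erase u) else 0) S
      = if u ∈ S then conv (sgnInd adj) G (S.erase u) else 0 := by
  unfold conv
  split_ifs with hu
  · have hsub : (S.erase u).powerset ⊆ S.powerset :=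
      Finset.powerset_mono.mpr (Finset.erase_subset _ _)
    rw [← Finset.sum_subset hsub]
    · refine Finset.sum_congr rfl fun J hJ => ?_
      rw [Finset.mem_powerset] at hJ
      have : u ∉ J := fun h => by simpa using hJ h
      beta_reduce
      rw [if_pos (Finset.mem_sdiff.mpr ⟨hu, this⟩)]
      congr 2
      ext x; simp only [Finset.mem_erase, Finset.mem_sdiff]; tauto
    · intro J hJ hJ'
      rw [Finset.mem_powerset] at hJ hJ'
      have : u ∈ J := by
        by_contra h
        exact hJ' (fun x hx => Finset.mem_erase.mpr ⟨fun e => h (e ▸ hx), hJ hx⟩)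
      simp [this]
  · refine Finset.sum_eq_zero fun J hJ => ?_
    simp [hu]

variable {adj}

open Classical in
/-- closed neighbourhood -/
noncomputable def nbr (adj : ι → ι → Prop) (u : ι) : Finset ι :=
  Finset.univ.filter fun j => j = u ∨ adj u j

lemma sgnInd_insert (hsymm : ∀ i j, adj i j → adj j i) (hirr : ∀ i, ¬ adj i i)
    (u : ι) (S : Finset ι) (hu : u ∈ S) :
    sgnInd adj S = - (if Disjoint (S.erase u) (nbr adj u) then sgnInd adj (S.erase u) else 0) := by
  by_cases hd : Disjoint (S.erase u) (nbr adj u)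
  · rw [if_pos hd]
    have : Indep adj S ↔ Indep adj (S.erase u) := by
      constructor
      · intro h i hi j hj
        exact h i (Finset.mem_of_mem_erase hi) j (Finset.mem_of_mem_erase hj)
      · have key : ∀ j ∈ S, ¬ adj u j := by
          intro j hj ha
          have hne : j ≠ u := by rintro rfl; exact hirr _ ha
          exact Finset.disjoint_left.mp hd (Finset.mem_erase.mpr ⟨hne, hj⟩)
            (by simp [nbr, ha])
        intro h i hi j hj ha
        by_cases h1 : i = u
        · subst h1; exact key j hj ha
        by_cases h2 : j = u
        · subst h2; exact key i hi (hsymm _ _ ha)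
        exact h i (by simp [h1, hi]) j (by simp [h2, hj]) ha
    unfold sgnInd
    by_cases hi : Indep adj S
    · rw [if_pos hi, if_pos (this.mp hi)]
      rw [← Finset.card_erase_add_one hu, pow_succ]; ring
    · rw [if_neg hi, if_neg (fun h => hi (this.mpr h))]; simp
  · rw [if_neg hd, neg_zero, sgnInd, if_neg]
    intro h
    rw [Finset.not_disjoint_iff] at hd
    obtain ⟨j, hj, hj'⟩ := hd
    simp only [Finset.mem_erase, nbr, Finset.mem_filter, Finset.mem_univ, true_and] at hj hj'
    exact h u hu j hj.2 (hj'.resolve_left hj.1)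

lemma rB_insert (hsymm : ∀ i j, adj i j → adj j i) (hirr : ∀ i, ¬ adj i i)
    (u : ι) (B : Finset ι) (hu : u ∉ B) (S : Finset ι) :
    rB adj (insert u B) S = rB adj B S +
      if u ∈ S then rB adj (B ∪ nbr adj u) (S.erase u) else 0 := by
  refine conv_unique adj (G := rB adj (insert u B)) (G' := fun S => rB adj B S +
      if u ∈ S then rB adj (B ∪ nbr adj u) (S.erase u) else 0) (fun S => ?_) S
  have h1 : conv (sgnInd adj) (fun S => rB adj B S +
      if u ∈ S then rB adj (B ∪ nbr adj u) (S.erase u) else 0) S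
      = conv (sgnInd adj) (rB adj B) S + conv (sgnInd adj)
        (fun S => if u ∈ S then rB adj (B ∪ nbr adj u) (S.erase u) else 0) S := by
    simp only [conv, mul_add, Finset.sum_add_distrib]
  rw [h1, conv_shift, conv_rB, conv_rB, conv_rB]
  unfold rhsB
  by_cases huS : u ∈ S
  · rw [if_pos huS, if_neg (by simp [huS]), sgnInd_insert hsymm hirr u S huS]
    have e1 : Disjoint (S.erase u) (B ∪ nbr adj u) ↔
        Disjoint S B ∧ Disjoint (S.erase u) (nbr adj u) := by
      rw [Finset.disjoint_union_right]
      refine and_congr_left fun _ => ?_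
      simp only [Finset.disjoint_left, Finset.mem_erase]
      refine ⟨fun h a ha hb => h ⟨?_, ha⟩ hb, fun h a ha => h ha.2⟩
      rintro rfl; exact hu hb
    simp only [e1]
    by_cases h1 : Disjoint S B <;> by_cases h2 : Disjoint (S.erase u) (nbr adj u) <;> simp [h1, h2]
  · simp [huS]

lemma rB_emptyB (S : Finset ι) : rB adj ∅ S = if S = ∅ then 1 else 0 := by
  refine conv_unique adj (G := rB adj ∅) (G' := fun S => if S = ∅ then 1 else 0) (fun S => ?_) S
  rw [conv_rB]
  unfold conv rhsB
  rw [Finset.sum_eq_single S]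
  · simp
  · intro J hJ hne
    rw [Finset.mem_powerset] at hJ
    have : ¬ (S \ J = ∅) := by
      rw [Finset.sdiff_eq_empty_iff_subset]
      exact fun h => hne (Finset.Subset.antisymm hJ h)
    simp [this]
  · simp

lemma rB_nonneg (hsymm : ∀ i j, adj i j → adj j i) (hirr : ∀ i, ¬ adj i i)
    (n : ℕ) : ∀ (S B : Finset ι), S.card ≤ n → 0 ≤ rB adj B S := by
  induction n with
  | zero =>
    intro S B hS
    have : S = ∅ := by simpa using hS
    subst this
    rw [rB_emptyS]; norm_num
  | succ n ih =>
    intro S B hS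
    induction B using Finset.induction_on with
    | empty => rw [rB_emptyB]; split_ifs <;> norm_num
    | insert u B hu ihB =>
      rw [rB_insert hsymm hirr u B hu]
      refine add_nonneg ihB ?_
      split_ifs with h
      · refine ih _ _ ?_
        rw [Finset.card_erase_of_mem h]; omega
      · exact le_refl _

/-- every component of `S` meets `B` -/
def Meets (adj : ι → ι → Prop) (B S : Finset ι) : Prop :=
  ∀ T ⊆ S, T.Nonempty → Disjoint T B → ∃ i ∈ T, ∃ j ∈ S, j ∉ T ∧ adj i j

lemma rB_pos (hsymm : ∀ i j, adj i j → adj j i) (hirr : ∀ i, ¬ adj i i)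
    (n : ℕ) : ∀ (S B : Finset ι), S.card ≤ n → Meets adj B S → 0 < rB adj B S := by
  induction n with
  | zero =>
    intro S B hS _
    have : S = ∅ := by simpa using hS
    subst this
    rw [rB_emptyS]; norm_num
  | succ n ih =>
    intro S B hS hM
    rcases S.eq_empty_or_nonempty with rfl | hne
    · rw [rB_emptyS]; norm_num
    have : ¬ Disjoint S B := by
      intro hd
      obtain ⟨i, hi, j, hj, hj', _⟩ := hM S (le_refl _) hne hd
      exact hj' hj
    rw [Finset.not_disjoint_iff] at this
    obtain ⟨u, huS, huB⟩ := this
    rw [← Finset.insert_erase huB, rB_insert hsymm hirr u _ (by simp), if_pos huS]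
    refine add_pos_of_nonneg_of_pos (rB_nonneg hsymm hirr S.card _ _ le_rfl) (ih _ _ ?_ ?_)
    · rw [Finset.card_erase_of_mem huS]; omega
    · intro T hT hTne hd
      rw [Finset.disjoint_union_right] at hd
      have huT : u ∉ T := fun h => by simpa using hT h
      obtain ⟨i, hi, j, hj, hj', ha⟩ := hM T (hT.trans (Finset.erase_subset _ _)) hTne (by
        rw [Finset.disjoint_left]
        intro a ha hb
        exact Finset.disjoint_left.mp hd.1 ha
          (Finset.mem_erase.mpr ⟨fun e => huT (e ▸ ha), hb⟩))
      refine ⟨i, hi, j, Finset.mem_erase.mpr ⟨?_, hj⟩, hj', ha⟩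
      rintro rfl
      exact Finset.disjoint_left.mp hd.2 hi (by simp [nbr, hsymm _ _ ha])

/-- The key combinatorial non-vanishing. -/
lemma key_comb (hsymm : ∀ i j, adj i j → adj j i) (hirr : ∀ i, ¬ adj i i)
    (hconn : ∀ T : Finset ι, T.Nonempty → T ≠ Finset.univ →
      ∃ i ∈ T, ∃ j ∉ T, adj i j) (v : ι) (G : Finset ι → ℝ) (c : ℝ) (hc : c ≠ 0)
    (hG : ∀ S, conv (sgnInd adj) G S = if v ∈ S then c * sgnInd adj S else 0) :
    G Finset.univ ≠ 0 := by
  have h := conv_unique adj (G := G)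
    (G' := fun S => if v ∈ S then (fun S => -c * rB adj (nbr adj v) S) (S.erase v) else 0)
    (fun S => by
      rw [hG, conv_shift adj v (fun S => -c * rB adj (nbr adj v) S)]
      split_ifs with hv
      · have : conv (sgnInd adj) (fun S => -c * rB adj (nbr adj v) S) (S.erase v)
          = -c * conv (sgnInd adj) (rB adj (nbr adj v)) (S.erase v) := by
          unfold conv
          rw [Finset.mul_sum]
          exact Finset.sum_congr rfl fun _ _ => by ring
        rw [this, conv_rB, sgnInd_insert hsymm hirr v S hv, rhsB]
        ring
      · rfl) Finset.univ
  rw [h, if_pos (Finset.mem_univ v)]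
  refine mul_ne_zero (neg_ne_zero.mpr hc) (ne_of_gt ?_)
  refine rB_pos hsymm hirr _ _ _ le_rfl ?_
  intro T hT hne hd
  have hvT : v ∉ T := fun h => by simpa using hT h
  obtain ⟨i, hi, j, hj, ha⟩ := hconn T hne (fun e => hvT (e ▸ Finset.mem_univ v))
  refine ⟨i, hi, j, ?_, hj, ha⟩
  simp only [Finset.mem_erase, Finset.mem_univ, and_true]
  rintro rfl
  exact Finset.disjoint_left.mp hd hi (by simp [nbr, hsymm _ _ ha])

end Comb

end RajanAux


namespace RajanAux

set_option linter.unusedSectionVars false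
set_option linter.unusedSimpArgs false

section Ser

variable {ι : Type} [Fintype ι] [DecidableEq ι] {adj : ι → ι → Prop} 

/-- exponent supported on `S` -/
noncomputable def expo (ν : ι → ℕ) (S : Finset ι) : ι →₀ ℕ :=
  Finsupp.equivFunOnFinite.symm (fun i => if i ∈ S then ν i else 0)

@[simp] lemma expo_apply (ν : ι → ℕ) (S : Finset ι) (i : ι) :
    expo ν S i = if i ∈ S then ν i else 0 := rfl

/-- Euler operator -/
noncomputable def euler (v : ι) (p : MvPolynomial ι ℂ) : MvPolynomial ι ℂ :=
  MvPolynomial.X v * MvPolynomial.pderiv v p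

lemma coeff_euler (v : ι) (p : MvPolynomial ι ℂ) (k : ι →₀ ℕ) :
    (euler v p).coeff k = k v * p.coeff k := by
  induction p using MvPolynomial.induction_on' with
  | monomial u a =>
    unfold euler
    rw [MvPolynomial.pderiv_monomial, MvPolynomial.X, MvPolynomial.monomial_mul,
      MvPolynomial.coeff_monomial, MvPolynomial.coeff_monomial]
    by_cases h : u v = 0
    · simp only [h]
      by_cases h2 : u = k
      · subst h2; simp [h]
      · simp [h2]
    · have : Finsupp.single v 1 + (u - Finsupp.single v 1) = u := by
        ext i
        by_cases hi : v = i
        · subst hi; simp; omega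
        · simp [Finsupp.single_apply, hi]
      rw [this]
      split_ifs with h2
      · subst h2; ring
      · simp
  | add p q hp hq =>
    unfold euler at *
    simp only [map_add, mul_add, MvPolynomial.coeff_add, hp, hq]

lemma euler_mul (v : ι) (p q : MvPolynomial ι ℂ) :
    euler v (p * q) = euler v p * q + p * euler v q := by
  unfold euler
  simp only [Derivation.leibniz, smul_eq_mul]
  ring

lemma euler_one (v : ι) : euler v (1 : MvPolynomial ι ℂ) = 0 := by
  unfold euler; simp

/-- the properties of the truncated numerators used in the argument -/
structure Good (adj : ι → ι → Prop) (ν : ι → ℕ) (p : MvPolynomial ι ℂ) : Prop where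
  gap : ∀ k, p.coeff k ≠ 0 → ∀ i, k i = 0 ∨ ν i ≤ k i
  ind : ∀ S, p.coeff (expo ν S) = ((sgnInd adj S : ℝ) : ℂ)
  pos : ∀ i, 0 < ν i

lemma Good.coeff_zero {ν : ι → ℕ} {p : MvPolynomial ι ℂ} (h : Good adj ν p) : p.coeff 0 = 1 := by
  have := h.ind ∅
  rw [sgnInd_empty] at this
  have e : expo ν ∅ = 0 := by ext; simp
  simpa [e] using this

lemma Good.ne_zero {ν : ι → ℕ} {p : MvPolynomial ι ℂ} (h : Good adj ν p) : p ≠ 0 := by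
  rintro rfl
  simpa using h.coeff_zero

/-- logarithmic derivative -/
noncomputable def LD (v : ι) (p : MvPolynomial ι ℂ) : MvPowerSeries ι ℂ :=
  (euler v p : MvPowerSeries ι ℂ) * (p : MvPowerSeries ι ℂ)⁻¹

lemma mul_LD (v : ι) (p : MvPolynomial ι ℂ) (h : p.coeff 0 = 1) :
    (p : MvPowerSeries ι ℂ) * LD v p = (euler v p : MvPowerSeries ι ℂ) := by
  unfold LD
  have : MvPowerSeries.constantCoeff (p : MvPowerSeries ι ℂ) ≠ 0 := by
    rw [← MvPowerSeries.coeff_zero_eq_constantCoeff_apply, MvPolynomial.coeff_coe, h]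
    exact one_ne_zero
  rw [mul_left_comm, MvPowerSeries.mul_inv_cancel _ this, mul_one]

lemma LD_rec (v : ι) (p : MvPolynomial ι ℂ) (h : p.coeff 0 = 1) (k : ι →₀ ℕ) :
    ∑ x ∈ Finset.HasAntidiagonal.antidiagonal k, p.coeff x.1 * MvPowerSeries.coeff x.2 (LD v p)
      = k v * p.coeff k := by
  have := congrArg (MvPowerSeries.coeff k) (mul_LD v p h)
  rw [MvPowerSeries.coeff_mul] at this
  simpa [MvPolynomial.coeff_coe, coeff_euler] using this

lemma LD_coeff_zero (v i : ι) (p : MvPolynomial ι ℂ) (h : p.coeff 0 = 1) (ν : ι →₀ ℕ)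
    (hp : ∀ k, k ≤ ν → p.coeff k ≠ 0 → k i = 0) (n : ℕ) :
    ∀ k : ι →₀ ℕ, k.degree ≤ n → k ≤ ν → k i ≠ 0 → MvPowerSeries.coeff k (LD v p) = 0 := by
  induction n with
  | zero =>
    intro k hk _ hki
    have : k = 0 := by rw [← Finsupp.degree_eq_zero_iff]; omega
    simp [this] at hki
  | succ n ih =>
    intro k hk hkν hki
    have h1 := LD_rec v p h k
    have h2 : p.coeff k = 0 := by
      by_contra h3
      exact hki (hp k hkν h3)
    rw [h2, mul_zero, Finset.sum_eq_single (0, k)] at h1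
    · simpa [h] using h1
    · rintro ⟨a, b⟩ hab hne
      rw [Finset.HasAntidiagonal.mem_antidiagonal] at hab
      dsimp only at hab ⊢
      by_cases ha : p.coeff a = 0
      · simp [ha]
      have hai : a i = 0 := hp a (le_trans (by rw [← hab]; exact le_self_add) hkν) ha
      have ha0 : a ≠ 0 := by
        rintro rfl
        apply hne
        simpa using hab
      rw [ih b ?_ ?_ ?_, mul_zero]
      · have : a.degree + b.degree = k.degree := by rw [← hab, map_add]
        have : a.degree ≠ 0 := by rwa [Ne, Finsupp.degree_eq_zero_iff]
        omega
      · exact le_trans (by rw [← hab]; exact le_add_self) hkν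
      · rw [← hab, Finsupp.add_apply, hai, zero_add] at hki
        exact hki
    · simp

lemma Good.LD_ne_zero {ν : ι → ℕ} {p : MvPolynomial ι ℂ} (hp : Good adj ν p)
    (hsymm : ∀ i j, adj i j → adj j i) (hirr : ∀ i, ¬ adj i i)
    (hconn : ∀ T : Finset ι, T.Nonempty → T ≠ Finset.univ →
      ∃ i ∈ T, ∃ j ∉ T, adj i j) (v : ι) :
    MvPowerSeries.coeff (expo ν Finset.univ) (LD v p) ≠ 0 := by
  intro h0
  refine key_comb hsymm hirr hconn v
    (fun S => (MvPowerSeries.coeff (expo ν S) (LD v p)).re) (ν v) ?_ ?_ ?_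
  · exact_mod_cast (hp.pos v).ne'
  · intro S
    have h1 := LD_rec v p hp.coeff_zero (expo ν S)
    have hsum : ∑ x ∈ Finset.HasAntidiagonal.antidiagonal (expo ν S),
        p.coeff x.1 * MvPowerSeries.coeff x.2 (LD v p)
        = ∑ J ∈ S.powerset, ((sgnInd adj J : ℝ) : ℂ) *
          MvPowerSeries.coeff (expo ν (S \ J)) (LD v p) := by
      symm
      refine Finset.sum_of_injOn (fun J => (expo ν J, expo ν (S \ J))) ?_ ?_ ?_ ?_
      · intro J _ J' _ hJJ
        have h2 := congrArg Prod.fst hJJ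
        dsimp only at h2
        ext i
        have h3 := DFunLike.congr_fun h2 i
        have := hp.pos i
        simp only [expo_apply] at h3
        split_ifs at h3 <;> first | tauto | omega
      · intro J hJ
        have hJ' : J ⊆ S := by simpa using hJ
        rw [Finset.mem_coe, Finset.HasAntidiagonal.mem_antidiagonal]
        ext i
        simp only [Finsupp.add_apply, expo_apply, Finset.mem_sdiff]
        have := @hJ' i
        split_ifs <;> first | tauto | omega
      · rintro ⟨a, b⟩ hab hnot
        rw [Finset.HasAntidiagonal.mem_antidiagonal] at hab
        dsimp only at hab ⊢
        by_contra hne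
        apply hnot
        have ha : p.coeff a ≠ 0 := left_ne_zero_of_mul hne
        have hg := hp.gap a ha
        have hai : ∀ i, a i + b i = if i ∈ S then ν i else 0 := fun i => by
          rw [← Finsupp.add_apply, hab, expo_apply]
        refine ⟨Finset.univ.filter (fun i => a i ≠ 0), ?_, ?_⟩
        · simp only [Finset.coe_powerset, Set.mem_preimage, Set.mem_powerset_iff,
            Finset.coe_subset]
          intro i hi
          simp only [Finset.mem_filter, Finset.mem_univ, true_and] at hi
          by_contra hiS
          have := hai i
          rw [if_neg hiS] at this
          omega
        · refine Prod.ext ?_ ?_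
          · ext i
            have h3 := hai i
            have h4 := hg i
            simp only [expo_apply, Finset.mem_filter, Finset.mem_univ, true_and]
            split_ifs at h3 ⊢ <;> omega
          · ext i
            have h3 := hai i
            have h4 := hg i
            have := hp.pos i
            simp only [expo_apply, Finset.mem_filter, Finset.mem_univ, true_and, Finset.mem_sdiff]
            by_cases hiS : i ∈ S <;> by_cases hi0 : a i = 0 <;> simp [hiS, hi0] at h3 h4 ⊢ <;> omega
      · intro J _
        rw [hp.ind]
    rw [hsum, hp.ind] at h1
    have h5 := congrArg Complex.re h1
    rw [Complex.re_sum] at h5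
    simp only [Complex.re_ofReal_mul] at h5
    unfold conv
    rw [h5]
    simp only [expo_apply]
    split_ifs
    · simp [← Complex.ofReal_natCast, ← Complex.ofReal_mul]
    · simp
  · show (MvPowerSeries.coeff (expo ν Finset.univ) (LD v p)).re = 0
    rw [h0]; simp

lemma prod_LD (v : ι) (s : Multiset (ι → ℕ)) (U : (ι → ℕ) → MvPolynomial ι ℂ)
    (hs : ∀ ν ∈ s, Good adj ν (U ν)) :
    ((s.map U).prod : MvPowerSeries ι ℂ) * (s.map (fun ν => LD v (U ν))).sum
      = (euler v (s.map U).prod : MvPowerSeries ι ℂ) := by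
  induction s using Multiset.induction_on with
  | empty => simp [euler_one]
  | cons a s ih =>
    have h1 := ih (fun ν hν => hs ν (Multiset.mem_cons_of_mem hν))
    have h2 := mul_LD v (U a) (hs a (Multiset.mem_cons_self a s)).coeff_zero
    simp only [Multiset.map_cons, Multiset.prod_cons, Multiset.sum_cons, euler_mul,
      MvPolynomial.coe_mul, MvPolynomial.coe_add]
    rw [← h1, ← h2]
    ring

lemma prod_ne_zero (s : Multiset (ι → ℕ)) (U : (ι → ℕ) → MvPolynomial ι ℂ)
    (hs : ∀ ν ∈ s, Good adj ν (U ν)) : (s.map U).prod ≠ 0 := by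
  intro h
  rw [Multiset.prod_eq_zero_iff] at h
  rw [Multiset.mem_map] at h
  obtain ⟨ν, h1, h2⟩ := h
  exact (hs ν h1).ne_zero h2

lemma sum_LD_coeff (v : ι) (s : Multiset (ι → ℕ)) (U : (ι → ℕ) → MvPolynomial ι ℂ)
    (hs : ∀ ν ∈ s, Good adj ν (U ν)) (ν : ι → ℕ) (hν0 : ∀ i, 0 < ν i)
    (hν : ∀ μ ∈ s, μ ≤ ν → μ = ν) :
    MvPowerSeries.coeff (expo ν Finset.univ) (s.map (fun ν => LD v (U ν))).sum
      = s.count ν * MvPowerSeries.coeff (expo ν Finset.univ) (LD v (U ν)) := by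
  induction s using Multiset.induction_on with
  | empty => simp
  | cons a s ih =>
    have h1 := ih (fun ν hν => hs ν (Multiset.mem_cons_of_mem hν))
      (fun μ hμ => hν μ (Multiset.mem_cons_of_mem hμ))
    rw [Multiset.map_cons, Multiset.sum_cons, map_add, h1, Multiset.count_cons]
    have hga := hs a (Multiset.mem_cons_self a s)
    by_cases ha : ν = a
    · subst ha; simp; ring
    · have h2 : ¬ a ≤ ν := fun h => ha (hν a (Multiset.mem_cons_self a s) h).symm
      rw [Pi.le_def] at h2
      push Not at h2
      obtain ⟨i, hi⟩ := h2
      rw [LD_coeff_zero v i (U a) hga.coeff_zero (expo ν Finset.univ) ?_ _ _ le_rfl le_rfl ?_]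
      · simp [ha]
      · intro k hk hne
        rcases hga.gap k hne i with h | h
        · exact h
        · have := hk i
          simp at this
          omega
      · simpa using (hν0 i).ne'

/-- unique factorisation for good families -/
theorem unique_multiset [Nonempty ι] (hsymm : ∀ i j, adj i j → adj j i) (hirr : ∀ i, ¬ adj i i)
    (hconn : ∀ T : Finset ι, T.Nonempty → T ≠ Finset.univ →
      ∃ i ∈ T, ∃ j ∉ T, adj i j) (U : (ι → ℕ) → MvPolynomial ι ℂ) (n : ℕ) :
    ∀ (s t : Multiset (ι → ℕ)), (∀ ν ∈ s, Good adj ν (U ν)) → (∀ ν ∈ t, Good adj ν (U ν)) →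
    s.card + t.card ≤ n → (s.map U).prod = (t.map U).prod → s = t := by
  induction n with
  | zero =>
    intro s t _ _ h _
    have h1 : s = 0 := by rw [← Multiset.card_eq_zero]; omega
    have h2 : t = 0 := by rw [← Multiset.card_eq_zero]; omega
    rw [h1, h2]
  | succ n ih =>
    intro s t hs ht hcard hprod
    by_cases hst : (s + t) = 0
    · rw [add_eq_zero] at hst
      rw [hst.1, hst.2]
    obtain ⟨v⟩ := ‹Nonempty ι›
    obtain ⟨ν, hνmem, hνmin⟩ := (s + t).toFinset.exists_minimal (by
      rw [Multiset.toFinset_nonempty]; exact hst)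
    rw [Multiset.mem_toFinset] at hνmem
    have hmin : ∀ μ ∈ s + t, μ ≤ ν → μ = ν := fun μ hμ hle =>
      le_antisymm hle (hνmin (Multiset.mem_toFinset.mpr hμ) hle)
    have hgood : Good adj ν (U ν) := by
      rcases Multiset.mem_add.mp hνmem with h | h
      · exact hs ν h
      · exact ht ν h
    have e1 := prod_LD v s U hs
    have e2 := prod_LD v t U ht
    rw [hprod] at e1
    have hne : (((t.map U).prod : MvPolynomial ι ℂ) : MvPowerSeries ι ℂ) ≠ 0 := by
      rw [Ne, ← MvPolynomial.coe_zero, MvPolynomial.coe_inj]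
      exact prod_ne_zero t U ht
    have e3 := mul_left_cancel₀ hne (e1.trans e2.symm)
    have e4 := congrArg (MvPowerSeries.coeff (expo ν Finset.univ)) e3
    rw [sum_LD_coeff v s U hs ν hgood.pos (fun μ hμ => hmin μ (Multiset.mem_add.mpr (.inl hμ))),
      sum_LD_coeff v t U ht ν hgood.pos (fun μ hμ => hmin μ (Multiset.mem_add.mpr (.inr hμ)))] at e4
    have e5 := mul_right_cancel₀ (hgood.LD_ne_zero hsymm hirr hconn v) e4
    have e6 : s.count ν = t.count ν := by exact_mod_cast e5
    have hmem : ν ∈ s ∧ ν ∈ t := by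
      rw [← Multiset.count_pos, ← Multiset.count_pos, ← e6, and_self]
      have : 0 < (s + t).count ν := Multiset.count_pos.mpr hνmem
      rw [Multiset.count_add] at this
      omega
    obtain ⟨s', rfl⟩ := Multiset.exists_cons_of_mem hmem.1
    obtain ⟨t', rfl⟩ := Multiset.exists_cons_of_mem hmem.2
    rw [ih s' t' (fun μ hμ => hs μ (Multiset.mem_cons_of_mem hμ))
      (fun μ hμ => ht μ (Multiset.mem_cons_of_mem hμ))
      (by simp at hcard; omega) ?_]
    simp only [Multiset.map_cons, Multiset.prod_cons] at hprod
    exact mul_left_cancel₀ hgood.ne_zero hprod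

end Ser

end RajanAux

set_option linter.unusedSectionVars false
namespace RajanAux
open Finset

section comb
variable {ι : Type} [Fintype ι] [DecidableEq ι]

/-- The pairing of `ν - ∑ k_j α_j` with the `i`-th simple coroot. -/
def cc (A : ι → ι → ℤ) (n : ι → ℤ) (k : ι → ℤ) (i : ι) : ℤ := n i - ∑ j, A i j * k j

/-- The reflection action in coordinates. -/
def refl (A : ι → ι → ℤ) (n : ι → ℤ) (i : ι) (k : ι → ℤ) : ι → ℤ :=
  Function.update k i (k i + cc A n k i)

/-- The norm defect. -/
def NN (A : ι → ι → ℤ) (d : ι → ℝ) (n : ι → ℤ) (k : ι → ℤ) : ℝ :=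
  ∑ i, (k i : ℝ) * d i * (n i + cc A n k i)

/-- Cartan data. -/
structure Cart (A : ι → ι → ℤ) (d : ι → ℝ) : Prop where
  two : ∀ i, A i i = 2
  neg : ∀ i j, i ≠ j → A i j ≤ 0
  dpos : ∀ i, 0 < d i
  symm : ∀ i j, d i * A i j = d j * A j i

/-- Antisymmetric functions supported on the cone. -/
structure Anti (A : ι → ι → ℤ) (n : ι → ℤ) (u : (ι → ℤ) → ℂ) : Prop where
  supp : ∀ k, u k ≠ 0 → ∀ i, 0 ≤ k i
  anti : ∀ i k, u (refl A n i k) = - u k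

variable {A : ι → ι → ℤ} {d : ι → ℝ} {n : ι → ℤ} {u : (ι → ℤ) → ℂ}

lemma sum_refl (i : ι) (k : ι → ℤ) : ∑ j, refl A n i k j = ∑ j, k j + cc A n k i := by
  unfold refl
  rw [Finset.sum_update_of_mem (mem_univ i), ← Finset.add_sum_erase univ k (mem_univ i),
    Finset.sdiff_singleton_eq_erase]
  ring

lemma gap_aux (hA : Cart A d) (hu : Anti A n u) (hn : ∀ i, 1 ≤ n i)
    (hN : ∀ k, u k ≠ 0 → NN A d n k = 0) (N : ℕ) :
    ∀ k, u k ≠ 0 → (∑ j, k j).toNat ≤ N → ∀ i, k i = 0 ∨ n i ≤ k i := by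
  induction N using Nat.strong_induction_on with
  | _ N ih =>
  intro k hk hkN i
  by_contra! hcon
  obtain ⟨h0, h1⟩ := hcon
  have hpos := hu.supp k hk
  by_cases hj : ∃ j, cc A n k j < 0
  · obtain ⟨j, hj⟩ := hj
    have hk' : u (refl A n j k) ≠ 0 := by rw [hu.anti]; simpa using hk
    have hpos' := hu.supp _ hk'
    have hs := sum_refl (A := A) (n := n) j k
    have hsp : 0 ≤ ∑ l, refl A n j k l := Finset.sum_nonneg fun l _ => hpos' l
    have hlt : (∑ l, refl A n j k l).toNat < N := by omega
    have := ih _ hlt _ hk' le_rfl i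
    by_cases hij : i = j
    · subst hij
      have hr : refl A n i k i = k i + cc A n k i := by simp [refl]
      rw [hr] at this
      have h3 : k i + cc A n k i = 0 := by omega
      have h4 : ∑ l, A i l * k l ≤ 2 * k i := by
        rw [← Finset.add_sum_erase univ _ (mem_univ i), hA.two]
        have : ∑ x ∈ univ.erase i, A i x * k x ≤ 0 := Finset.sum_nonpos fun x hx =>
          mul_nonpos_of_nonpos_of_nonneg (hA.neg i x (Finset.ne_of_mem_erase hx).symm) (hpos x)
        omega
      unfold cc at h3
      omega
    · have hr : refl A n j k i = k i := by simp [refl, hij]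
      rw [hr] at this
      omega
  · push Not at hj
    have h2 := hN k hk
    have h3 : 0 < NN A d n k := by
      unfold NN
      have hki : 0 < k i := lt_of_le_of_ne (hpos i) (Ne.symm h0)
      refine Finset.sum_pos' (fun l _ => ?_) ⟨i, mem_univ i, ?_⟩
      · have := hpos l; have := hA.dpos l; have := hj l; have := hn l
        have a1 : (0:ℝ) ≤ k l := by exact_mod_cast hpos l
        have a2 : (0:ℝ) ≤ n l + cc A n k l := by exact_mod_cast (by omega : 0 ≤ n l + cc A n k l)
        positivity
      · have := hA.dpos i
        have a1 : (0:ℝ) < k i := by exact_mod_cast hki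
        have := hj i; have := hn i
        have a2 : (0:ℝ) < n i + cc A n k i := by exact_mod_cast (by omega : 0 < n i + cc A n k i)
        positivity
    linarith

lemma gap (hA : Cart A d) (hu : Anti A n u) (hn : ∀ i, 1 ≤ n i)
    (hN : ∀ k, u k ≠ 0 → NN A d n k = 0) (k) (hk : u k ≠ 0) (i) : k i = 0 ∨ n i ≤ k i :=
  gap_aux hA hu hn hN _ k hk le_rfl i

/-- integer version of the exponent of a set -/
def ex (n : ι → ℤ) (S : Finset ι) : ι → ℤ := fun i => if i ∈ S then n i else 0

/-- The Dynkin graph. -/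
def dyn (A : ι → ι → ℤ) (i j : ι) : Prop := i ≠ j ∧ A i j ≠ 0

lemma u_ex_indep (hA : Cart A d) (hu : Anti A n u) (h0 : u 0 = 1) (S : Finset ι) :
    (∀ i ∈ S, ∀ j ∈ S, ¬ dyn A i j) → u (ex n S) = (-1) ^ S.card := by
  induction S using Finset.induction_on with
  | empty =>
    intro _
    have : ex n (∅ : Finset ι) = 0 := by ext; simp [ex]
    simp [this, h0]
  | insert i S hi ih =>
    intro h
    have h1 := ih fun a ha b hb => h a (mem_insert_of_mem ha) b (mem_insert_of_mem hb)
    have hc : cc A n (ex n S) i = n i := by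
      unfold cc
      rw [Finset.sum_eq_zero]; · ring
      intro j _
      unfold ex
      split_ifs with hj
      · have h2 := h i (mem_insert_self _ _) j (mem_insert_of_mem hj)
        unfold dyn at h2
        have : i ≠ j := by rintro rfl; exact hi hj
        push Not at h2
        rw [h2 this, zero_mul]
      · simp
    have h2 : refl A n i (ex n S) = ex n (insert i S) := by
      ext j
      unfold refl
      rw [hc]
      by_cases hj : j = i
      · subst hj; simp [ex, hi]
      · simp [hj, ex]
    rw [← h2, hu.anti, h1, card_insert_of_notMem hi, pow_succ]
    ring

lemma u_ex_dep (hA : Cart A d) (hn : ∀ i, 1 ≤ n i)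
    (hN : ∀ k, u k ≠ 0 → NN A d n k = 0) (S : Finset ι) (i j : ι) (hi : i ∈ S) (hj : j ∈ S)
    (hij : dyn A i j) : u (ex n S) = 0 := by
  by_contra hne
  have h := hN _ hne
  have hneg : ∀ l ∈ S, ∀ x ∈ univ.erase l, A l x * ex n S x ≤ 0 := fun l hl x hx => by
    refine mul_nonpos_of_nonpos_of_nonneg (hA.neg l x (Finset.ne_of_mem_erase hx).symm) ?_
    unfold ex; split_ifs
    · have := hn x; omega
    · exact le_rfl
  have key : ∀ l ∈ S, n l + cc A n (ex n S) l = - ∑ x ∈ univ.erase l, A l x * ex n S x := by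
    intro l hl
    unfold cc
    rw [← Finset.add_sum_erase univ _ (mem_univ l), hA.two]
    simp only [ex, hl, if_true]
    ring
  have h3 : 0 < NN A d n (ex n S) := by
    unfold NN
    refine Finset.sum_pos' (fun l _ => ?_) ⟨i, mem_univ i, ?_⟩
    · by_cases hl : l ∈ S
      · have h4 := key l hl
        have h5 : 0 ≤ n l + cc A n (ex n S) l := by
          rw [h4]; have := Finset.sum_nonpos (hneg l hl); omega
        have := hA.dpos l
        have a1 : (0:ℝ) ≤ ex n S l := by
          have := hn l
          simp only [ex, hl, if_true]; exact_mod_cast (by omega : 0 ≤ n l)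
        have a2 : (0:ℝ) ≤ n l + cc A n (ex n S) l := by exact_mod_cast h5
        positivity
      · simp [ex, hl]
    · have h4 := key i hi
      have h5 : 0 < n i + cc A n (ex n S) i := by
        rw [h4]
        have : ∑ x ∈ univ.erase i, A i x * ex n S x < 0 := by
          refine Finset.sum_neg' (hneg i hi) ⟨j, by simp [hij.1.symm], ?_⟩
          have := hn j
          simp only [ex, hj, if_true]
          exact mul_neg_of_neg_of_pos (lt_of_le_of_ne (hA.neg i j hij.1) hij.2) (by omega)
        omega
      have := hA.dpos i
      have a1 : (0:ℝ) < ex n S i := by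
        have := hn i
        simp only [ex, hi, if_true]; exact_mod_cast (by omega : 0 < n i)
      have a2 : (0:ℝ) < n i + cc A n (ex n S) i := by exact_mod_cast h5
      positivity
  linarith

/-- Denominator type statement: for `ρ` the norm condition is automatic. -/
lemma delta_aux (hA : Cart A d) (hu : Anti A 1 u) (r : ι → ℕ)
    (hr : ∀ i, ∑ j, A i j * (r j : ℤ) = 2)
    (hNr : ∀ i k, NN A d 1 (refl A 1 i k) = NN A d 1 k) (N : ℕ) :
    ∀ k, u k ≠ 0 → (∑ j, k j).toNat ≤ N → NN A d 1 k = 0 := by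
  induction N using Nat.strong_induction_on with
  | _ N ih =>
  intro k hk hkN
  have hpos := hu.supp k hk
  by_cases hj : ∃ j, cc A 1 k j < 0
  · obtain ⟨j, hj⟩ := hj
    have hk' : u (refl A 1 j k) ≠ 0 := by rw [hu.anti]; simpa using hk
    have hpos' := hu.supp _ hk'
    have hs := sum_refl (A := A) (n := 1) j k
    have hsp : 0 ≤ ∑ l, refl A 1 j k l := Finset.sum_nonneg fun l _ => hpos' l
    have hlt : (∑ l, refl A 1 j k l).toNat < N := by omega
    rw [← hNr j]
    exact ih _ hlt _ hk' le_rfl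
  · push Not at hj
    have hj1 : ∀ j, 1 ≤ cc A 1 k j := by
      intro j
      have h1 := hj j
      have h2 : cc A 1 k j ≠ 0 := by
        intro h0
        have h3 := hu.anti j k
        have h4 : refl A 1 j k = k := by ext x; simp [refl, h0]
        rw [h4] at h3
        exact hk (self_eq_neg.mp h3)
      omega
    have h5 : ∑ i, (k i : ℝ) * d i * 2 = ∑ j, (r j : ℝ) * d j * (1 - cc A 1 k j) := by
      calc ∑ i, (k i : ℝ) * d i * 2 = ∑ i, ∑ j, (k i : ℝ) * d i * (A i j * r j) := by
            refine Finset.sum_congr rfl fun i _ => ?_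
            rw [← Finset.mul_sum]
            congr 1
            exact_mod_cast (hr i).symm
        _ = ∑ j, ∑ i, (k i : ℝ) * d i * (A i j * r j) := Finset.sum_comm
        _ = _ := by
            refine Finset.sum_congr rfl fun j _ => ?_
            unfold cc
            push_cast
            simp only [Pi.one_apply, Int.cast_one, sub_sub_cancel, Finset.mul_sum]
            refine Finset.sum_congr rfl fun i _ => ?_
            have := hA.symm i j
            linear_combination (k i : ℝ) * r j * this
    have h6 : ∑ j, (r j : ℝ) * d j * (1 - cc A 1 k j) ≤ 0 := by
      refine Finset.sum_nonpos fun j _ => ?_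
      have := hA.dpos j
      have a : (1:ℝ) ≤ cc A 1 k j := by exact_mod_cast hj1 j
      exact mul_nonpos_of_nonneg_of_nonpos (by positivity) (by linarith)
    have h7 : ∀ i, (k i : ℝ) * d i * 2 = 0 := by
      have h8 : ∀ i ∈ univ, 0 ≤ (k i : ℝ) * d i * 2 := fun i _ => by
        have := hA.dpos i
        have a : (0:ℝ) ≤ k i := by exact_mod_cast hpos i
        positivity
      intro i
      exact (Finset.sum_eq_zero_iff_of_nonneg h8).1
        (le_antisymm (h5.trans_le h6) (Finset.sum_nonneg h8)) i (mem_univ i)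
    unfold NN
    refine Finset.sum_eq_zero fun i _ => ?_
    have := h7 i
    have h9 : (k i : ℝ) * d i = 0 := by linarith
    rw [h9, zero_mul]

end comb
end RajanAux

set_option linter.unusedSectionVars false
namespace RajanAux
open Finset

section GAsec
variable {E : Type} [AddCommGroup E] 

/-- group algebra -/
abbrev GA (E : Type) [AddCommGroup E] := AddMonoidAlgebra ℂ E

/-- formal exponential -/
noncomputable def ee (μ : E) : GA E := AddMonoidAlgebra.single μ 1

/-- coefficientwise multiplication by a function -/
noncomputable def wm (c : E → ℂ) (f : GA E) : GA E :=
  AddMonoidAlgebra.ofCoeff (Finsupp.ofSupportFinite (fun μ => c μ * f.coeff μ)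
    (f.coeff.hasFiniteSupport.subset fun μ h => by
      simp only [Function.mem_support, ne_eq, mul_eq_zero, not_or] at h ⊢
      exact h.2))

@[simp] lemma coeff_wm (c : E → ℂ) (f : GA E) (μ : E) : (wm c f).coeff μ = c μ * f.coeff μ := rfl

lemma ga_ext {f g : GA E} (h : ∀ μ, f.coeff μ = g.coeff μ) : f = g :=
  AddMonoidAlgebra.coeff_injective (Finsupp.ext h)

lemma wm_add (c : E → ℂ) (f g : GA E) : wm c (f + g) = wm c f + wm c g :=
  ga_ext fun μ => by simp [mul_add]

lemma wm_sub (c : E → ℂ) (f g : GA E) : wm c (f - g) = wm c f - wm c g :=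
  ga_ext fun μ => by simp [mul_sub]

lemma wm_zero (c : E → ℂ) : wm c (0 : GA E) = 0 := ga_ext fun μ => by simp

lemma wm_single (c : E → ℂ) (μ : E) (r : ℂ) :
    wm c (AddMonoidAlgebra.single μ r) = c μ • AddMonoidAlgebra.single μ r :=
  ga_ext fun x => by
    classical
    simp only [coeff_wm, AddMonoidAlgebra.coeff_single, AddMonoidAlgebra.coeff_smul,
      Finsupp.smul_apply, Finsupp.single_apply, smul_eq_mul]
    split_ifs with h
    · rw [h]
    · simp

@[simp] lemma coeff_single_mul' (μ : E) (r : ℂ) (f : GA E) (x : E) :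
    (AddMonoidAlgebra.single μ r * f).coeff x = r * f.coeff (x - μ) :=
  AddMonoidAlgebra.coeff_single_mul_eq_mul_coeff _ fun m' _ => by
    rw [eq_sub_iff_add_eq, add_comm]

lemma coeff_ee_mul (μ : E) (f : GA E) (x : E) : (ee μ * f).coeff x = f.coeff (x - μ) := by
  rw [ee, coeff_single_mul', one_mul]

lemma ee_mul (μ ν : E) : ee μ * ee ν = ee (μ + ν) := by
  simp [ee, AddMonoidAlgebra.single_mul_single]

lemma ee_zero : ee (0 : E) = 1 := rfl

lemma wm_ee (c : E → ℂ) (μ : E) : wm c (ee μ) = c μ • ee μ := wm_single c μ 1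

lemma wm_mul (c : E →+ ℂ) (f g : GA E) : wm c (f * g) = wm c f * g + f * wm c g := by
  induction f using AddMonoidAlgebra.induction_linear with
  | zero => simp [wm_zero]
  | add f₁ f₂ h₁ h₂ => rw [add_mul, wm_add, h₁, h₂, wm_add]; ring
  | single μ r =>
    refine ga_ext fun x => ?_
    rw [wm_single]
    simp only [coeff_wm, coeff_single_mul', smul_mul_assoc, AddMonoidAlgebra.coeff_add,
      AddMonoidAlgebra.coeff_smul, Finsupp.add_apply, Finsupp.smul_apply, smul_eq_mul]
    have : c x = c μ + c (x - μ) := by rw [← map_add]; congr 1; abel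
    rw [this]; ring

lemma wm_prod {P : Type} [DecidableEq P] (c : E →+ ℂ) (s : Finset P) (F : P → GA E) :
    wm c (∏ β ∈ s, F β) = ∑ β ∈ s, wm c (F β) * ∏ γ ∈ s.erase β, F γ := by
  induction s using Finset.induction_on with
  | empty =>
    simp only [prod_empty, sum_empty]
    rw [← ee_zero, wm_ee]; simp
  | insert a s ha ih =>
    rw [prod_insert ha, wm_mul, sum_insert ha, erase_insert ha, ih, Finset.mul_sum]
    congr 1
    refine Finset.sum_congr rfl fun β hβ => ?_
    have hne : a ≠ β := by rintro rfl; exact ha hβ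
    rw [erase_insert_of_ne hne, prod_insert (by simp [ha])]
    ring

end GAsec
end RajanAux

set_option linter.unusedSectionVars false
namespace RajanAux
open Finset

/-- abstract root data -/
structure RD (E ι P : Type) [AddCommGroup E] [Module ℂ E] [Fintype ι] [Fintype P]
    [DecidableEq ι] where
  root : P → E
  simple : ι → P
  li : LinearIndependent ℂ (fun i => root (simple i))
  B : E →ₗ[ℂ] E →ₗ[ℂ] ℂ
  symm : ∀ x y, B x y = B y x
  cov : ι → E →ₗ[ℂ] ℂ
  d : ι → ℝ
  dpos : ∀ i, 0 < d i
  hB : ∀ i x, B (root (simple i)) x = d i * cov i x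
  A : ι → ι → ℤ
  hA : ∀ i j, cov i (root (simple j)) = A i j
  two : ∀ i, A i i = 2
  neg : ∀ i j, i ≠ j → A i j ≤ 0
  pos : ∀ β, ∃ k : ι → ℕ, root β = ∑ i, k i • root (simple i)
  perm : ι → Equiv.Perm P
  perm_simple : ∀ i, perm i (simple i) = simple i
  perm_root : ∀ i β, β ≠ simple i →
    root (perm i β) = root β - cov i (root β) • root (simple i)
  cov_inj : ∀ x, (∀ i, cov i x = 0) → x = 0
  root_ne : ∀ β, root β ≠ 0

namespace RD
variable {E ι P : Type} [AddCommGroup E] [Module ℂ E] [Fintype ι] [Fintype P]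
    [DecidableEq ι] (R : RD E ι P)

/-- simple roots -/
def α (i : ι) : E := R.root (R.simple i)

/-- half sum of positive roots -/
noncomputable def ρ : E := (2⁻¹ : ℂ) • ∑ β, R.root β

/-- simple reflection -/
def s (i : ι) : E ≃+ E where
  toFun x := x - R.cov i x • R.α i
  invFun x := x - R.cov i x • R.α i
  left_inv x := by
    have := R.hA i i
    simp only [map_sub, map_smul, α, this, R.two, smul_eq_mul, sub_smul]
    push_cast
    rw [mul_comm, mul_smul, two_smul]
    abel
  right_inv x := by
    have := R.hA i i
    simp only [map_sub, map_smul, α, this, R.two, smul_eq_mul, sub_smul]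
    push_cast
    rw [mul_comm, mul_smul, two_smul]
    abel
  map_add' x y := by
    simp only [map_add, add_smul]; abel

lemma s_apply (i : ι) (x : E) : R.s i x = x - R.cov i x • R.α i := rfl
lemma s_symm (i : ι) : (R.s i).symm = R.s i := rfl

lemma hB' (i : ι) (x : E) : R.B x (R.α i) = R.d i * R.cov i x := by
  rw [R.symm]; exact R.hB i x

lemma B_s (i : ι) (x y : E) : R.B (R.s i x) (R.s i y) = R.B x y := by
  have h1 : R.B (R.α i) (R.α i) = R.d i * 2 := by
    rw [R.hB']; congr 1; unfold α; rw [R.hA, R.two]; norm_num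
  have h2 : R.B (R.α i) y = R.d i * R.cov i y := R.hB i y
  simp only [s_apply, map_sub, map_smul, LinearMap.sub_apply, LinearMap.smul_apply, h1, h2, R.hB',
    smul_eq_mul]
  ring

lemma α_ne (i : ι) : R.α i ≠ 0 := R.li.ne_zero i

lemma s_ρ (i : ι) : R.s i R.ρ = R.ρ - R.α i := by
  classical
  have h1 : R.cov i R.ρ • R.α i = R.α i := by
    have h2 : ∑ β, R.root (R.perm i β) = ∑ β, R.root β := Equiv.sum_comp _ _
    rw [← Finset.add_sum_erase univ _ (mem_univ (R.simple i)), R.perm_simple,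
      Finset.sum_congr rfl (fun β hβ => R.perm_root i β (ne_of_mem_erase hβ)),
      Finset.sum_sub_distrib, ← Finset.sum_smul] at h2
    conv_rhs at h2 => rw [← Finset.add_sum_erase univ _ (mem_univ (R.simple i))]
    have h3 : (∑ β ∈ univ.erase (R.simple i), R.cov i (R.root β)) • R.root (R.simple i) = 0 := by
      have h4 := sub_eq_self.mp (add_left_cancel h2)
      exact h4
    unfold ρ
    rw [map_smul, map_sum, ← Finset.add_sum_erase univ _ (mem_univ (R.simple i)), smul_eq_mul,
      mul_add, add_smul, R.hA, R.two]
    unfold α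
    rw [mul_smul _ (∑ β ∈ univ.erase (R.simple i), R.cov i (R.root β)), h3]
    norm_num
  rw [s_apply, h1]

lemma cov_ρ (i : ι) : R.cov i R.ρ = 1 := by
  have h := R.s_ρ i
  rw [s_apply] at h
  have h2 := sub_right_injective h
  have h3 : (R.cov i R.ρ - 1) • R.α i = 0 := by rw [sub_smul, one_smul]; exact sub_eq_zero.mpr h2
  rcases smul_eq_zero.mp h3 with h4 | h4
  · exact sub_eq_zero.mp h4
  · exact absurd h4 (R.α_ne i)

lemma cart : Cart R.A R.d where
  two := R.two
  neg := R.neg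
  dpos := R.dpos
  symm i j := by
    have h1 := R.hB i (R.α j)
    have h2 := R.hB' j (R.α i)
    unfold α at h1 h2
    rw [h1, R.hA, R.hA] at h2
    exact_mod_cast h2

/-- root lattice element with integer coordinates -/
noncomputable def Q (k : ι → ℤ) : E := ∑ i, k i • R.α i

lemma Q_inj : Function.Injective R.Q := by
  intro k l h
  have h1 := (Fintype.linearIndependent_iff.mp R.li) (fun i => ((k i - l i : ℤ) : ℂ)) (by
    have : ∑ i, ((k i - l i : ℤ) : ℂ) • R.root (R.simple i) = R.Q k - R.Q l := by
      unfold Q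
      rw [← Finset.sum_sub_distrib]
      refine Finset.sum_congr rfl fun i _ => ?_
      rw [Int.cast_smul_eq_zsmul, sub_smul]; rfl
    rw [this, h, sub_self])
  ext i
  have := h1 i
  have : k i - l i = 0 := by exact_mod_cast this
  omega

lemma cov_Q (i : ι) (k : ι → ℤ) : R.cov i (R.Q k) = ((∑ j, R.A i j * k j : ℤ) : ℂ) := by
  unfold Q α
  rw [map_sum]
  push_cast
  refine Finset.sum_congr rfl fun j _ => ?_
  rw [map_zsmul, R.hA, zsmul_eq_mul, mul_comm]

lemma Q_update (k : ι → ℤ) (i : ι) (t : ℤ) :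
    R.Q (Function.update k i (k i + t)) = R.Q k + t • R.α i := by
  unfold Q
  rw [← Finset.add_sum_erase univ _ (mem_univ i), ← Finset.add_sum_erase univ _ (mem_univ i)]
  rw [Function.update_self, add_smul, Finset.sum_congr rfl (fun j hj => by
    rw [Function.update_of_ne (ne_of_mem_erase hj)])]
  abel

lemma cov_sub (ν : E) (n : ι → ℤ) (hν : ∀ i, R.cov i ν = n i) (k : ι → ℤ) (i : ι) :
    R.cov i (ν - R.Q k) = (cc R.A n k i : ℤ) := by
  rw [map_sub, hν, cov_Q]; unfold cc; push_cast; rfl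

lemma s_sub (ν : E) (n : ι → ℤ) (hν : ∀ i, R.cov i ν = n i) (k : ι → ℤ) (i : ι) :
    R.s i (ν - R.Q k) = ν - R.Q (refl R.A n i k) := by
  rw [s_apply, R.cov_sub ν n hν, refl, Q_update, Int.cast_smul_eq_zsmul]
  abel

lemma norm_sub (ν : E) (n : ι → ℤ) (hν : ∀ i, R.cov i ν = n i) (k : ι → ℤ) :
    R.B (ν - R.Q k) (ν - R.Q k) = R.B ν ν - (NN R.A R.d n k : ℝ) := by
  have h1 : ∀ x, R.B (R.Q k) x = ∑ i, (k i : ℂ) * R.d i * R.cov i x := by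
    intro x
    unfold Q
    rw [map_sum, LinearMap.sum_apply]
    refine Finset.sum_congr rfl fun i _ => ?_
    rw [map_zsmul, LinearMap.smul_apply]
    unfold α
    rw [R.hB, zsmul_eq_mul]; ring
  have h2 : R.B (ν - R.Q k) (ν - R.Q k)
      = R.B ν ν - (R.B (R.Q k) ν + R.B (R.Q k) (ν - R.Q k)) := by
    simp only [map_sub, LinearMap.sub_apply]
    rw [R.symm ν (R.Q k)]; ring
  rw [h2, h1, h1, ← Finset.sum_add_distrib]
  congr 1
  unfold NN
  push_cast
  refine Finset.sum_congr rfl fun i _ => ?_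
  rw [R.cov_sub ν n hν, hν]
  ring

/-- the exponent map -/
noncomputable def q : (ι →₀ ℕ) →+ E where
  toFun k := - R.Q (fun i => (k i : ℤ))
  map_zero' := by simp [Q]
  map_add' k l := by
    unfold Q
    rw [← neg_add, ← Finset.sum_add_distrib]
    congr 1
    refine Finset.sum_congr rfl fun i _ => ?_
    dsimp only
    rw [Finsupp.add_apply, Nat.cast_add, add_smul]

lemma q_apply (k : ι →₀ ℕ) : R.q k = - R.Q (fun i => (k i : ℤ)) := rfl

lemma q_inj : Function.Injective R.q := by
  intro k l h
  rw [q_apply, q_apply] at h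
  have := R.Q_inj (neg_injective h)
  ext i
  exact_mod_cast congrFun this i

/-- the substitution `X_i ↦ e^{-α_i}` -/
noncomputable def φ : MvPolynomial ι ℂ →ₐ[ℂ] GA E := AddMonoidAlgebra.mapDomainAlgHom ℂ ℂ R.q

lemma φ_inj : Function.Injective R.φ := by
  unfold φ
  intro x y h
  exact AddMonoidAlgebra.mapDomain_injective R.q_inj h

lemma coeff_φ (p : MvPolynomial ι ℂ) (k : ι →₀ ℕ) : (R.φ p).coeff (R.q k) = p.coeff k := by
  unfold φ
  exact Finsupp.mapDomain_apply R.q_inj _ _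

lemma coeff_φ_ne (p : MvPolynomial ι ℂ) (x : E) (h : (R.φ p).coeff x ≠ 0) : ∃ k, x = R.q k := by
  by_contra! hc
  apply h
  unfold φ
  exact Finsupp.mapDomain_of_notMem_range _ _ (by rintro ⟨k, rfl⟩; exact hc k rfl)

lemma φ_monomial (k : ι →₀ ℕ) (r : ℂ) :
    R.φ (MvPolynomial.monomial k r) = AddMonoidAlgebra.single (R.q k) r := by
  unfold φ
  exact AddMonoidAlgebra.mapDomain_single 

/-- elements of the completed form `e^ν φ(p)` -/
def Form (ν : E) (f : GA E) (p : MvPolynomial ι ℂ) : Prop := f = ee ν * R.φ p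

variable {R}
lemma Form.mul {ν ν' : E} {f f' : GA E} {p p'} (h : R.Form ν f p) (h' : R.Form ν' f' p') :
    R.Form (ν + ν') (f * f') (p * p') := by
  unfold Form at *
  rw [h, h', map_mul, ← ee_mul]; ring

lemma Form.coeff {ν : E} {f : GA E} {p} (h : R.Form ν f p) (k : ι →₀ ℕ) :
    f.coeff (ν - R.Q (fun i => (k i : ℤ))) = p.coeff k := by
  rw [h, coeff_ee_mul]
  rw [← R.coeff_φ]; congr 1; rw [q_apply]; abel

lemma Form.supp {ν : E} {f : GA E} {p} (h : R.Form ν f p) (x : E) (hx : f.coeff x ≠ 0) :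
    ∃ k : ι →₀ ℕ, x = ν - R.Q (fun i => (k i : ℤ)) := by
  rw [h, coeff_ee_mul] at hx
  obtain ⟨k, hk⟩ := R.coeff_φ_ne p _ hx
  refine ⟨k, ?_⟩
  rw [q_apply] at hk
  rw [sub_eq_iff_eq_add.mp hk]; abel

lemma exists_form {ν : E} {f : GA E}
    (h : ∀ x, f.coeff x ≠ 0 → ∃ k : ι → ℕ, x = ν - R.Q (fun i => (k i : ℤ))) :
    ∃ p, R.Form ν f p := by
  classical
  have hinj : Function.Injective (fun k : ι →₀ ℕ => ν + R.q k) := fun k l hkl =>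
    R.q_inj (add_left_cancel hkl)
  refine ⟨AddMonoidAlgebra.ofCoeff (Finsupp.comapDomain (fun k : ι →₀ ℕ => ν + R.q k) f.coeff
    hinj.injOn), ?_⟩
  refine ga_ext fun x => ?_
  rw [coeff_ee_mul]
  by_cases hx : ∃ k : ι →₀ ℕ, x = ν + R.q k
  · obtain ⟨k, rfl⟩ := hx
    rw [add_sub_cancel_left, R.coeff_φ]
    rfl
  · have h1 : f.coeff x = 0 := by
      by_contra hne
      obtain ⟨k, hk⟩ := h x hne
      exact hx ⟨Finsupp.equivFunOnFinite.symm k, by rw [hk, q_apply, sub_eq_add_neg]; rfl⟩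
    rw [h1]
    by_contra hne
    obtain ⟨k, hk⟩ := R.coeff_φ_ne _ _ (Ne.symm hne)
    exact hx ⟨k, by rw [← hk]; abel⟩

end RD
end RajanAux

set_option linter.unusedSectionVars false
namespace RajanAux
open Finset
namespace RD
variable {E ι P : Type} [AddCommGroup E] [Module ℂ E] [Fintype ι] [Fintype P]
    [DecidableEq ι] (R : RD E ι P)

/-- Weyl denominator -/
noncomputable def Δ : GA E := ee R.ρ * ∏ β, (1 - ee (-R.root β))

/-- norm operator -/
noncomputable def Lop (f : GA E) : GA E := wm (fun μ => R.B μ μ) f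

/-- additive functional -/
noncomputable def Bm (x : E) : E →+ ℂ := (R.B x).toAddMonoidHom

lemma Bm_apply (x y : E) : R.Bm x y = R.B x y := rfl

/-- reflection on group algebra -/
noncomputable def S (i : ι) : GA E ≃ₐ[ℂ] GA E := AddMonoidAlgebra.domCongr ℂ ℂ (R.s i)

lemma S_ee (i : ι) (x : E) : R.S i (ee x) = ee (R.s i x) := AddMonoidAlgebra.domCongr_single ..

lemma coeff_S (i : ι) (f : GA E) (x : E) : (R.S i f).coeff x = f.coeff (R.s i x) :=
  AddMonoidAlgebra.coeff_domCongr ..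

lemma s_root (i : ι) (β : P) (h : β ≠ R.simple i) : R.s i (R.root β) = R.root (R.perm i β) :=
  (R.perm_root i β h).symm

lemma s_α (i : ι) : R.s i (R.α i) = - R.α i := by
  rw [s_apply]
  have : R.cov i (R.α i) = 2 := by unfold α; rw [R.hA, R.two]; norm_num
  rw [this, two_smul]; abel

lemma S_Δ (i : ι) : R.S i R.Δ = - R.Δ := by
  classical
  unfold Δ
  rw [map_mul, map_prod, S_ee, s_ρ, ← Finset.mul_prod_erase univ _ (mem_univ (R.simple i)),
    ← Finset.mul_prod_erase univ _ (mem_univ (R.simple i))]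
  have h1 : ∏ x ∈ univ.erase (R.simple i), (R.S i) (1 - ee (-R.root x))
      = ∏ x ∈ univ.erase (R.simple i), (1 - ee (-R.root x)) := by
    refine Finset.prod_equiv (R.perm i) ?_ ?_
    · intro β
      simp only [mem_erase, mem_univ, and_true, ne_eq, not_iff_not]
      constructor
      · rintro rfl; exact R.perm_simple i
      · intro h; rw [← R.perm_simple i] at h; exact (R.perm i).injective h
    · intro β hβ
      rw [map_sub, map_one, S_ee, map_neg, R.s_root i β (ne_of_mem_erase hβ)]
  rw [h1, map_sub, map_one, S_ee, map_neg]
  have h2 : R.s i (R.root (R.simple i)) = - R.α i := R.s_α i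
  rw [h2]
  have h3 : ee (R.ρ - R.α i) * (1 - ee (- - R.α i)) = - (ee R.ρ * (1 - ee (-R.α i))) := by
    rw [mul_sub, mul_sub, ee_mul, ee_mul]
    simp [sub_eq_add_neg]
  rw [← mul_assoc, h3]
  unfold α
  ring

lemma Δ_form : ∃ p, R.Form R.ρ R.Δ p ∧ p.coeff 0 = 1 := by
  choose k hk using R.pos
  refine ⟨∏ β, (1 - MvPolynomial.monomial (Finsupp.equivFunOnFinite.symm (k β)) 1), ?_, ?_⟩
  · unfold Form Δ
    rw [map_prod]
    congr 1
    refine Finset.prod_congr rfl fun β _ => ?_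
    rw [map_sub, map_one, φ_monomial]
    unfold ee
    congr 2
    rw [q_apply, hk, Q]
    congr 1
    refine Finset.sum_congr rfl fun i _ => ?_
    simp [α]
  · have : ∀ p : MvPolynomial ι ℂ, p.coeff 0 = MvPolynomial.constantCoeff p := fun p => rfl
    rw [this, map_prod]
    refine Finset.prod_eq_one fun β _ => ?_
    rw [map_sub, map_one, ← this, MvPolynomial.coeff_monomial, if_neg]; · simp
    intro h0
    apply R.root_ne β
    rw [hk]
    refine Finset.sum_eq_zero fun i _ => ?_
    have := DFunLike.congr_fun h0 i
    simp only [Finsupp.equivFunOnFinite_symm_apply_apply, Finsupp.coe_zero, Pi.zero_apply] at this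
    rw [this, zero_smul]

/-- coefficient function in coordinates -/
noncomputable def cf (ν : E) (f : GA E) (k : ι → ℤ) : ℂ := f.coeff (ν - R.Q k)

lemma anti_cf (ν : E) (n : ι → ℤ) (hν : ∀ i, R.cov i ν = n i) (f : GA E) {p} (hf : R.Form ν f p)
    (hS : ∀ i x, f.coeff (R.s i x) = - f.coeff x) : Anti R.A n (R.cf ν f) where
  supp k hk i := by
    obtain ⟨l, hl⟩ := hf.supp _ hk
    have := R.Q_inj (sub_right_injective hl)
    rw [this]; positivity
  anti i k := by
    unfold cf
    rw [← R.s_sub ν n hν, hS]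

lemma Δ_anti (i : ι) (x : E) : R.Δ.coeff (R.s i x) = - R.Δ.coeff x := by
  rw [← coeff_S, S_Δ]; rfl

lemma Lop_Δ : R.Lop R.Δ = R.B R.ρ R.ρ • R.Δ := by
  obtain ⟨p, hp, -⟩ := R.Δ_form
  have hν : ∀ i, R.cov i R.ρ = ((1 : ι → ℤ) i : ℤ) := fun i => by rw [cov_ρ]; simp
  have ha := R.anti_cf R.ρ 1 hν R.Δ hp R.Δ_anti
  choose k hk using R.pos
  refine ga_ext fun x => ?_
  unfold Lop
  rw [coeff_wm, AddMonoidAlgebra.coeff_smul_apply, smul_eq_mul]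
  by_cases hx : R.Δ.coeff x = 0
  · simp [hx]
  congr 1
  obtain ⟨l, rfl⟩ := hp.supp x hx
  rw [R.norm_sub _ 1 hν]
  have h2 : ∑ β, R.root β = ∑ j, (∑ β, k β j) • R.α j := by
    rw [Finset.sum_congr rfl (fun β _ => hk β), Finset.sum_comm]
    refine Finset.sum_congr rfl fun j _ => ?_
    rw [← Finset.sum_smul]; rfl
  have h1 : NN R.A R.d 1 (fun i => (l i : ℤ)) = 0 := by
    refine delta_aux R.cart ha (fun j => ∑ β, k β j) ?_ ?_ _ _ hx le_rfl
    · intro i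
      have h3 := R.cov_ρ i
      unfold ρ at h3
      have h4 : R.cov i (∑ β, R.root β) = 2 := by
        rw [map_smul, smul_eq_mul] at h3
        linear_combination 2 * h3
      have h5 : ∑ β, R.root β = R.Q (fun j => ((∑ β, k β j : ℕ) : ℤ)) := by
        rw [h2]; unfold Q
        refine Finset.sum_congr rfl fun j _ => ?_
        rw [natCast_zsmul]
      rw [h5, cov_Q] at h4
      exact_mod_cast h4
    · intro i m
      have h6 := R.norm_sub R.ρ 1 hν (refl R.A 1 i m)
      have h7 := R.norm_sub R.ρ 1 hν m
      rw [← R.s_sub R.ρ 1 hν, B_s, h7] at h6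
      have := sub_right_injective h6
      exact_mod_cast this.symm
  rw [h1]; simp

lemma Lop_single_mul (μ : E) (r : ℂ) (g : GA E) :
    R.Lop (AddMonoidAlgebra.single μ r * g) = AddMonoidAlgebra.single μ r *
      (R.B μ μ • g + (2:ℂ) • wm (R.Bm μ) g + R.Lop g) := by
  refine ga_ext fun x => ?_
  unfold Lop
  simp only [coeff_wm, coeff_single_mul', AddMonoidAlgebra.coeff_add, AddMonoidAlgebra.coeff_smul,
    Finsupp.add_apply, Finsupp.smul_apply, smul_eq_mul, Bm_apply]
  have : R.B x x = R.B μ μ + 2 * R.B μ (x - μ) + R.B (x - μ) (x - μ) := by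
    simp only [map_sub, LinearMap.sub_apply]
    rw [R.symm x μ]; ring
  rw [this]; ring

/-- partial denominators -/
noncomputable def D [DecidableEq P] (β : P) : GA E :=
  ee R.ρ * ∏ γ ∈ univ.erase β, (1 - ee (-R.root γ))

lemma D_mul [DecidableEq P] (β : P) : (1 - ee (-R.root β)) * R.D β = R.Δ := by
  unfold D Δ
  rw [← Finset.mul_prod_erase univ _ (mem_univ β)]; ring

lemma wm_Δ [DecidableEq P] (μ : E) :
    (2:ℂ) • wm (R.Bm μ) R.Δ = ∑ β, R.B (R.root β) μ • ((1 + ee (-R.root β)) * R.D β) := by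
  have hD : ∀ β, wm (R.Bm μ) (1 - ee (-R.root β)) = R.B (R.root β) μ • ee (-R.root β) := by
    intro β
    rw [wm_sub, ← ee_zero, wm_ee, wm_ee, Bm_apply, Bm_apply, map_neg, map_zero, R.symm μ]
    simp
  have hρ : (2:ℂ) * R.B μ R.ρ = ∑ β, R.B (R.root β) μ := by
    unfold ρ
    rw [map_smul, map_sum, smul_eq_mul, ← mul_assoc]
    norm_num
    exact Finset.sum_congr rfl fun β _ => R.symm _ _
  have h1 : wm (R.Bm μ) R.Δ = R.B μ R.ρ • R.Δ
      + ∑ β, R.B (R.root β) μ • (ee (-R.root β) * R.D β) := by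
    conv_lhs => rw [Δ]
    rw [wm_mul, wm_ee, Bm_apply, wm_prod, smul_mul_assoc, Finset.mul_sum]
    congr 1
    refine Finset.sum_congr rfl fun β _ => ?_
    rw [hD, smul_mul_assoc, mul_smul_comm]
    congr 1
    unfold D; ring
  rw [h1, smul_add, smul_smul, hρ, Finset.sum_smul, Finset.smul_sum, ← Finset.sum_add_distrib]
  refine Finset.sum_congr rfl fun β _ => ?_
  rw [← R.D_mul β, smul_comm (2:ℂ), ← smul_add]
  congr 1
  rw [two_smul]; ring

lemma Lop_mul_Δ [DecidableEq P] (f : GA E) : R.Lop (f * R.Δ) = R.Lop f * R.Δ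
    + f * R.Lop R.Δ + ∑ β, wm (R.Bm (R.root β)) f * ((1 + ee (-R.root β)) * R.D β) := by
  induction f using AddMonoidAlgebra.induction_linear with
  | zero => simp [Lop, wm_zero]
  | add f g hf hg =>
    have hadd : ∀ x y, R.Lop (x + y) = R.Lop x + R.Lop y := fun x y => wm_add _ x y
    rw [add_mul, hadd, hf, hg, hadd]
    simp only [wm_add, add_mul, Finset.sum_add_distrib]
    ring
  | single μ r =>
    rw [Lop_single_mul, wm_Δ]
    have h1 : R.Lop (AddMonoidAlgebra.single μ r) = R.B μ μ • AddMonoidAlgebra.single μ r :=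
      wm_single _ _ _
    rw [h1]
    simp only [wm_single, mul_add, Finset.mul_sum, mul_smul_comm, smul_mul_assoc, Bm_apply]
    ring

/-- characters of irreducible modules, abstractly -/
structure IsChar (lam : E) (χ : GA E) : Prop where
  supp : ∀ x, χ.coeff x ≠ 0 → ∃ k : ι → ℕ, x = lam - R.Q (fun i => (k i : ℤ))
  top : χ.coeff lam = 1
  inv : ∀ i x, χ.coeff (R.s i x) = χ.coeff x
  dom : ∀ i, ∃ n : ℕ, R.cov i lam = n
  cas : ∃ T : P → GA E, (∀ β, (1 - ee (-R.root β)) * T β = wm (R.B (R.root β)) χ) ∧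
    R.Lop χ + ∑ β, (1 + ee (-R.root β)) * T β = (R.B lam lam + 2 * R.B lam R.ρ) • χ

lemma isChar_one : R.IsChar 0 1 where
  supp x hx := by
    refine ⟨0, ?_⟩
    rw [AddMonoidAlgebra.one_def, AddMonoidAlgebra.coeff_single] at hx
    have : x = 0 := by
      by_contra h
      exact hx (Finsupp.single_eq_of_ne (by exact h))
    rw [this]; simp [Q]
  top := by rw [AddMonoidAlgebra.one_def, AddMonoidAlgebra.coeff_single]; simp
  inv i x := by rw [← coeff_S, map_one]
  dom i := ⟨0, by simp⟩
  cas := ⟨0, fun β => by rw [← ee_zero, wm_ee]; simp, by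
    unfold Lop; rw [← ee_zero, wm_ee]; simp⟩

variable {R}

lemma IsChar.Lop {lam : E} {χ : GA E} (h : R.IsChar lam χ) :
    R.Lop (χ * R.Δ) = R.B (lam + R.ρ) (lam + R.ρ) • (χ * R.Δ) := by
  classical
  obtain ⟨T, hT, hc⟩ := h.cas
  rw [Lop_mul_Δ, Lop_Δ]
  have h1 : ∑ β, wm (R.Bm (R.root β)) χ * ((1 + ee (-R.root β)) * R.D β)
      = (∑ β, (1 + ee (-R.root β)) * T β) * R.Δ := by
    rw [Finset.sum_mul]
    refine Finset.sum_congr rfl fun β _ => ?_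
    have h2 : wm (R.Bm (R.root β)) χ = (1 - ee (-R.root β)) * T β := (hT β).symm
    rw [h2, ← R.D_mul β]; ring
  rw [h1, add_right_comm, ← add_mul, hc]
  simp only [map_add, LinearMap.add_apply, mul_smul_comm, smul_mul_assoc, ← add_smul]
  congr 1
  rw [R.symm R.ρ lam]; ring

lemma IsChar.good {lam : E} {χ : GA E} (h : R.IsChar lam χ) (n : ι → ℕ)
    (hn : ∀ i, R.cov i lam = n i) :
    ∃ p, R.Form (lam + R.ρ) (χ * R.Δ) p ∧ Good (dyn R.A) (fun i => n i + 1) p := by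
  classical
  obtain ⟨p1, hp1⟩ := exists_form h.supp
  obtain ⟨p2, hp2, hp20⟩ := R.Δ_form
  have hf := hp1.mul hp2
  have hp10 : p1.coeff 0 = 1 := by
    rw [← hp1.coeff]
    convert h.top using 2
    simp [Q]
  have hcoeff := hf.coeff
  have hν : ∀ i, R.cov i (lam + R.ρ) = ((fun i => (n i : ℤ) + 1) i : ℤ) := fun i => by
    rw [map_add, hn, cov_ρ]; push_cast; rfl
  have hn1 : ∀ i, 1 ≤ (fun i => (n i : ℤ) + 1) i := fun i => by simp
  have hS : ∀ i x, (χ * R.Δ).coeff (R.s i x) = - (χ * R.Δ).coeff x := by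
    intro i x
    rw [← coeff_S, map_mul, S_Δ]
    have : R.S i χ = χ := ga_ext fun y => by rw [coeff_S, h.inv]
    rw [this, mul_neg]; rfl
  have ha := R.anti_cf _ _ hν _ hf hS
  have hN : ∀ k, R.cf (lam + R.ρ) (χ * R.Δ) k ≠ 0 → NN R.A R.d (fun i => (n i : ℤ) + 1) k = 0 := by
    intro k hk
    have h1 := congrArg (fun f => AddMonoidAlgebra.coeff f (lam + R.ρ - R.Q k)) h.Lop
    simp only [RD.Lop, coeff_wm, AddMonoidAlgebra.coeff_smul_apply, smul_eq_mul] at h1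
    have h2 := mul_right_cancel₀ hk h1
    rw [R.norm_sub _ _ hν] at h2
    have := sub_eq_self.mp h2
    exact_mod_cast this
  have hu0 : R.cf (lam + R.ρ) (χ * R.Δ) 0 = 1 := by
    have := hcoeff 0
    have h3 : (p1 * p2).coeff 0 = 1 := by
      change MvPolynomial.constantCoeff (p1 * p2) = 1
      rw [map_mul]
      change p1.coeff 0 * p2.coeff 0 = 1
      rw [hp10, hp20, one_mul]
    rw [h3] at this
    exact this
  refine ⟨_, hf, ⟨?_, ?_, ?_⟩⟩
  · intro k hk i
    rw [← hcoeff] at hk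
    have := gap R.cart ha hn1 hN _ hk i
    omega
  · intro S
    rw [← hcoeff]
    have h4 : (fun i => ((expo (fun i => n i + 1) S i : ℕ) : ℤ)) = ex (fun i => (n i : ℤ) + 1) S := by
      ext i
      simp only [expo_apply, ex]
      split_ifs <;> simp
    rw [h4]
    unfold sgnInd
    by_cases hS : Indep (dyn R.A) S
    · rw [if_pos hS]
      have := u_ex_indep R.cart ha hu0 S hS
      unfold cf at this
      rw [this]; push_cast; rfl
    · rw [if_neg hS]
      unfold Indep at hS
      push Not at hS
      obtain ⟨i, hi, j, hj, hij⟩ := hS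
      have := u_ex_dep R.cart hn1 hN S i j hi hj hij
      unfold cf at this
      rw [this]; simp
  · intro i; simp

lemma form_unique {a b : E} {f : GA E} {p p' : MvPolynomial ι ℂ} (h : R.Form a f p)
    (h' : R.Form b f p') (h0 : p.coeff 0 = 1) (h0' : p'.coeff 0 = 1) : p = p' := by
  have e1 : f.coeff a = 1 := by rw [← h0, ← h.coeff]; simp [Q]
  have e2 : f.coeff b = 1 := by rw [← h0', ← h'.coeff]; simp [Q]
  obtain ⟨k, hk⟩ := h'.supp a (by rw [e1]; simp)
  obtain ⟨l, hl⟩ := h.supp b (by rw [e2]; simp)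
  have h3 : R.q (k + l) = 0 := by
    rw [map_add, q_apply, q_apply]
    have : a + b = (b - R.Q fun i => (k i : ℤ)) + (a - R.Q fun i => (l i : ℤ)) := by
      rw [← hk, ← hl]
    have h4 : (b - R.Q fun i => (k i : ℤ)) + (a - R.Q fun i => (l i : ℤ))
      = a + b + ((-R.Q fun i => (k i : ℤ)) + (-R.Q fun i => (l i : ℤ))) := by abel
    rw [h4] at this
    exact left_eq_add.mp this
  have h4 : k + l = 0 := R.q_inj (by rw [h3, map_zero])
  have h5 : k = 0 := (add_eq_zero.mp h4).1
  have h6 : a = b := by rw [hk, h5]; simp [Q]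
  subst h6
  apply R.φ_inj
  unfold Form at h h'
  rw [h] at h'
  have := congrArg (fun g => ee (-a) * g) h'
  simpa only [← mul_assoc, ee_mul, neg_add_cancel, ee_zero, one_mul] using this

theorem unique [Nonempty ι] (hconn : ∀ T : Finset ι, T.Nonempty → T ≠ Finset.univ →
      ∃ i ∈ T, ∃ j ∉ T, dyn R.A i j) (ch : E → GA E) (s t : Multiset E)
    (hs : ∀ l ∈ s, l ≠ 0 ∧ R.IsChar l (ch l)) (ht : ∀ l ∈ t, l ≠ 0 ∧ R.IsChar l (ch l))
    (hprod : (s.map ch).prod = (t.map ch).prod) : s = t := by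
  classical
  have hsymm : ∀ i j, dyn R.A i j → dyn R.A j i := by
    rintro i j ⟨h1, h2⟩
    refine ⟨h1.symm, fun h3 => h2 ?_⟩
    have := R.cart.symm i j
    rw [h3, Int.cast_zero, mul_zero] at this
    rcases mul_eq_zero.mp this with h | h
    · exact absurd h (R.dpos i).ne'
    · exact_mod_cast h
  have hirr : ∀ i, ¬ dyn R.A i i := fun i h => h.1 rfl
  set ch' : E → GA E := Function.update ch 0 1 with hch'
  set s' := s + Multiset.replicate t.card 0 with hs'
  set t' := t + Multiset.replicate s.card 0 with ht'
  have hmap : ∀ s : Multiset E, (∀ l ∈ s, l ≠ 0 ∧ R.IsChar l (ch l)) → s.map ch' = s.map ch :=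
    fun s hs => Multiset.map_congr rfl fun l hl => by
      rw [hch', Function.update_of_ne (hs l hl).1]
  have hall : ∀ (s : Multiset E) (m : ℕ), (∀ l ∈ s, l ≠ 0 ∧ R.IsChar l (ch l)) →
      ∀ l ∈ s + Multiset.replicate m 0, R.IsChar l (ch' l) := by
    intro s m hs l hl
    by_cases h0 : l = 0
    · subst h0
      rw [hch', Function.update_self]; exact R.isChar_one
    · rw [hch', Function.update_of_ne h0]
      rcases Multiset.mem_add.mp hl with h | h
      · exact (hs l h).2
      · exact absurd (Multiset.eq_of_mem_replicate h) h0
  have hpr : ∀ (s : Multiset E) (m : ℕ), (∀ l ∈ s, l ≠ 0 ∧ R.IsChar l (ch l)) →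
      ((s + Multiset.replicate m 0).map ch').prod = (s.map ch).prod := by
    intro s m hs
    rw [Multiset.map_add, Multiset.prod_add, hmap s hs, Multiset.map_replicate, hch',
      Function.update_self, Multiset.prod_replicate, one_pow, mul_one]
  have hprod' : (s'.map ch').prod = (t'.map ch').prod := by
    rw [hs', ht', hpr s _ hs, hpr t _ ht, hprod]
  have hcard : s'.card = t'.card := by simp [hs', ht', add_comm]
  -- labels
  have hex : ∀ l : E, ∃ n : ι → ℕ, R.IsChar l (ch' l) → ∀ i, R.cov i l = n i := by
    intro l
    by_cases h : R.IsChar l (ch' l)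
    · choose n hn using h.dom
      exact ⟨n, fun _ => hn⟩
    · exact ⟨0, fun h' => absurd h' h⟩
  choose lab hlab using hex
  have hexp : ∀ l : E, ∃ p, R.IsChar l (ch' l) → R.Form (l + R.ρ) (ch' l * R.Δ) p ∧
      Good (dyn R.A) (fun i => lab l i + 1) p := by
    intro l
    by_cases h : R.IsChar l (ch' l)
    · obtain ⟨p, hp⟩ := h.good (lab l) (hlab l h)
      exact ⟨p, fun _ => hp⟩
    · exact ⟨0, fun h' => absurd h' h⟩
  choose pp hpp using hexp
  let good : Set E := {l | R.IsChar l (ch' l)}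
  let lb : E → (ι → ℕ) := fun l i => lab l i + 1
  have hinj : Set.InjOn lb good := by
    intro a ha b hb hab
    rw [← sub_eq_zero]
    apply R.cov_inj
    intro i
    rw [map_sub, hlab a ha, hlab b hb]
    have := congrFun hab i
    simp only [lb] at this
    have : lab a i = lab b i := by omega
    rw [this, sub_self]
  let U : (ι → ℕ) → MvPolynomial ι ℂ := fun ν => pp (Function.invFunOn lb good ν)
  have hU : ∀ l ∈ good, U (lb l) = pp l := fun l hl => by
    simp only [U]
    rw [hinj.leftInvOn_invFunOn hl]
  have hform : ∀ s : Multiset E, (∀ l ∈ s, R.IsChar l (ch' l)) →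
      R.Form (s.map (fun l => l + R.ρ)).sum ((s.map ch').prod * R.Δ ^ s.card) (s.map pp).prod ∧
      (s.map pp).prod.coeff 0 = 1 := by
    intro s
    induction s using Multiset.induction_on with
    | empty =>
      intro _
      constructor
      · simp [Form, ee_zero]
      · simp
    | cons a s ih =>
      intro h
      have h1 := ih fun l hl => h l (Multiset.mem_cons_of_mem hl)
      have h2 := hpp a (h a (Multiset.mem_cons_self a s))
      constructor
      · have := h2.1.mul h1.1
        simp only [Multiset.map_cons, Multiset.sum_cons, Multiset.prod_cons, Multiset.card_cons,
          pow_succ]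
        convert this using 1
        ring
      · rw [Multiset.map_cons, Multiset.prod_cons]
        change MvPolynomial.constantCoeff _ = 1
        rw [map_mul]
        change (pp a).coeff 0 * _ = 1
        rw [h2.2.coeff_zero, one_mul]
        exact h1.2
  have f1 := hform s' (hall s _ hs)
  have f2 := hform t' (hall t _ ht)
  rw [hprod', hcard] at f1
  have hpeq := form_unique f1.1 f2.1 f1.2 f2.2
  have hm : ∀ s : Multiset E, (∀ l ∈ s, R.IsChar l (ch' l)) → (s.map lb).map U = s.map pp := by
    intro s h
    rw [Multiset.map_map]
    exact Multiset.map_congr rfl fun l hl => hU l (h l hl)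
  have hg : ∀ s : Multiset E, (∀ l ∈ s, R.IsChar l (ch' l)) →
      ∀ ν ∈ s.map lb, Good (dyn R.A) ν (U ν) := by
    intro s h ν hν
    obtain ⟨l, hl, rfl⟩ := Multiset.mem_map.mp hν
    rw [hU l (h l hl)]
    exact (hpp l (h l hl)).2
  have hfin := unique_multiset hsymm hirr hconn U _ (s'.map lb) (t'.map lb)
    (hg s' (hall s _ hs)) (hg t' (hall t _ ht)) le_rfl
    (by rw [hm s' (hall s _ hs), hm t' (hall t _ ht), hpeq])
  have hst : s' = t' := by
    have h1 : ∀ s : Multiset E, (∀ l ∈ s, R.IsChar l (ch' l)) →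
        (s.map lb).map (Function.invFunOn lb good) = s := by
      intro s h
      rw [Multiset.map_map]
      conv_rhs => rw [← Multiset.map_id s]
      exact Multiset.map_congr rfl fun l hl => hinj.leftInvOn_invFunOn (h l hl)
    rw [← h1 s' (hall s _ hs), ← h1 t' (hall t _ ht), hfin]
  have hfilt : ∀ (s : Multiset E) (m : ℕ), (∀ l ∈ s, l ≠ 0 ∧ R.IsChar l (ch l)) →
      (s + Multiset.replicate m 0).filter (· ≠ 0) = s := by
    intro s m h
    rw [Multiset.filter_add, Multiset.filter_eq_self.mpr fun l hl => (h l hl).1,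
      Multiset.filter_eq_nil.mpr, add_zero]
    intro l hl
    simp [Multiset.eq_of_mem_replicate hl]
  exact (hfilt s t.card hs).symm.trans ((congrArg _ hst).trans (hfilt t s.card ht))

end RD
end RajanAux

set_option linter.unusedSectionVars false
namespace RajanAux
open Finset LieAlgebra LieAlgebra.IsKilling Module
section rd
variable {𝔤 : Type} [LieRing 𝔤] [LieAlgebra ℂ 𝔤] [FiniteDimensional ℂ 𝔤] [IsKilling ℂ 𝔤]
  (H : LieSubalgebra ℂ 𝔤) [H.IsCartanSubalgebra]

/-- the vector `t_x` in the Cartan subalgebra dual to `x` -/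
noncomputable def tt (x : Dual ℂ H) : H := (cartanEquivDual H).symm x

lemma traceForm_tt (x : Dual ℂ H) (h : H) : LieModule.traceForm ℂ H 𝔤 (tt H x) h = x h := by
  have : cartanEquivDual H ((cartanEquivDual H).symm x) h = x h := by
    rw [LinearEquiv.apply_symm_apply]
  exact this

/-- the dual form -/
noncomputable def dB : Dual ℂ H →ₗ[ℂ] Dual ℂ H →ₗ[ℂ] ℂ :=
  LinearMap.mk₂ ℂ (fun x y => x (tt H y)) (fun _ _ _ => rfl) (fun _ _ _ => rfl)
    (fun x y z => by simp [tt]) (fun c x y => by simp [tt])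

lemma dB_apply (x y : Dual ℂ H) : dB H x y = x (tt H y) := rfl

lemma dB_symm (x y : Dual ℂ H) : dB H x y = dB H y x := by
  rw [dB_apply, dB_apply, ← traceForm_tt H x (tt H y), ← traceForm_tt H y (tt H x),
    LieModule.traceForm_comm]

/-- the positive integer `κ(h_α,h_α)` -/
noncomputable def nrm (a : H.root) : ℤ := ∑ c : H.root, ((rootSystem H).pairingIn ℤ c a) ^ 2

lemma nrm_eq (a : H.root) : LieModule.traceForm ℂ H 𝔤 (coroot a.1) (coroot a.1) = nrm H a := by
  have h1 : LieModule.traceForm ℂ H 𝔤 (coroot a.1) (coroot a.1)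
     = (killingForm ℂ 𝔤).restrict H (coroot a.1) (coroot a.1) := rfl
  rw [h1, restrict_killingForm_eq_sum, ← Finset.sum_coe_sort]
  unfold nrm
  rw [LinearMap.sum_apply, LinearMap.sum_apply, Int.cast_sum]
  refine Finset.sum_congr rfl fun c _ => ?_
  have h2 : (((rootSystem H).pairingIn ℤ c a : ℤ) : ℂ) = c.1 (coroot a.1) := by
    have := (rootSystem H).algebraMap_pairingIn ℤ c a
    rw [rootSystem_pairing_apply] at this
    exact this
  rw [Int.cast_pow, h2]
  simp [sq]
  rfl

lemma nonzero_of_root (a : H.root) : a.1.IsNonZero := by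
  exact H.isNonZero_coe_root a

lemma nrm_pos (a : H.root) : 0 < nrm H a := by
  unfold nrm
  refine Finset.sum_pos' (fun c _ => sq_nonneg _) ⟨a, mem_univ _, ?_⟩
  rw [RootPairing.pairingIn_same]; norm_num

lemma tt_root (a : H.root) : tt H ((rootSystem H).root a) = ((2 : ℂ) / nrm H a) • coroot a.1 := by
  have h0 := root_apply_cartanEquivDual_symm_ne_zero (nonzero_of_root H a)
  have h1 := traceForm_coroot a.1 (coroot a.1)
  rw [nrm_eq, root_apply_coroot (nonzero_of_root H a)] at h1
  rw [h1, coroot]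
  simp only [tt, rootSystem_root_apply]
  rw [← Nat.cast_smul_eq_nsmul ℂ, ← Nat.cast_smul_eq_nsmul ℂ, smul_smul, smul_smul]
  conv_lhs => rw [← one_smul ℂ ((cartanEquivDual H).symm _)]
  congr 1
  simp only [smul_eq_mul]
  push_cast
  field_simp

open scoped Classical in
/-- The action on positive roots of a simple reflection. -/
noncomputable def prmF (b : (rootSystem H).Base) (i : b.support)
    (β : {a : H.root // b.IsPos a}) : {a : H.root // b.IsPos a} :=
  if h : β.1 = i.1 then β else
    ⟨(rootSystem H).reflectionPerm i.1 β.1, β.2.reflectionPerm i.2 h⟩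

lemma prmF_pos (b : (rootSystem H).Base) (i : b.support)
    (β : {a : H.root // b.IsPos a}) (h : β.1 = i.1) : prmF H b i β = β := dif_pos h

lemma prmF_neg (b : (rootSystem H).Base) (i : b.support)
    (β : {a : H.root // b.IsPos a}) (h : β.1 ≠ i.1) : prmF H b i β =
    ⟨(rootSystem H).reflectionPerm i.1 β.1, β.2.reflectionPerm i.2 h⟩ := dif_neg h

/-- The permutation of positive roots given by a simple reflection. -/
noncomputable def prm (b : (rootSystem H).Base) (i : b.support) :
    Equiv.Perm {a : H.root // b.IsPos a} :=
  Function.Involutive.toPerm (prmF H b i) (by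
    intro β
    by_cases h : β.1 = i.1
    · rw [prmF_pos H b i β h, prmF_pos H b i β h]
    · have h2 : (rootSystem H).reflectionPerm i.1 β.1 ≠ i.1 := by
        intro h3
        have h4 : β.1 = (rootSystem H).reflectionPerm i.1 i.1 := by
          have h6 := congrArg ((rootSystem H).reflectionPerm i.1) h3
          rwa [RootPairing.reflectionPerm_self] at h6
        have h5 := (RootPairing.Base.IsPos.neg_iff_not (b := b) i.1).mp (by
          have := β.2
          rw [h4] at this
          exact this)
        exact h5 (b.isPos_of_mem_support i.2)
      rw [prmF_neg H b i β h, prmF_neg H b i _ h2]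
      apply Subtype.ext
      simp)

open scoped Classical in
/-- root data of a Lie algebra -/
noncomputable def rdOf (b : (rootSystem H).Base) :
    RD (Dual ℂ H) b.support {a : H.root // b.IsPos a} where
  root β := (rootSystem H).root β.1
  simple i := ⟨i.1, b.isPos_of_mem_support i.2⟩
  li := b.linearIndepOn_root
  B := dB H
  symm := dB_symm H
  cov i := Module.Dual.eval ℂ H (coroot i.1.1)
  d i := 2 / nrm H i.1
  dpos i := by have := nrm_pos H i.1; positivity
  hB i x := by
    rw [dB_symm, dB_apply, tt_root, map_smul]; push_cast; rfl
  A i j := (rootSystem H).pairingIn ℤ j.1 i.1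
  hA i j := by
    have := (rootSystem H).algebraMap_pairingIn ℤ j.1 i.1
    rw [rootSystem_pairing_apply] at this
    exact this.symm
  two i := by rw [RootPairing.pairingIn_same]
  neg i j hij := b.pairingIn_le_zero_of_ne (fun h => hij (Subtype.ext h.symm)) j.2 i.2
  pos β := by
    obtain ⟨f, hf, h | h⟩ := b.exists_root_eq_sum_nat_or_neg β.1
    · refine ⟨fun i => f i, ?_⟩
      rw [h, ← Finset.sum_coe_sort]
    · exfalso
      have hp := β.2
      rw [RootPairing.Base.isPos_iff, RootPairing.Base.height_eq_sum (f := fun j => -(f j : ℤ))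
        (by rw [h, ← Finset.sum_neg_distrib]; simp)] at hp
      have : ∑ j ∈ b.support, -(f j : ℤ) ≤ 0 := Finset.sum_nonpos fun j _ => by omega
      omega
  perm := prm H b
  perm_simple i := prmF_pos H b i _ rfl
  perm_root i β hβ := by
    have : β.1 ≠ i.1 := fun h => hβ (Subtype.ext h)
    have h2 : prm H b i β = ⟨(rootSystem H).reflectionPerm i.1 β.1,
        β.2.reflectionPerm i.2 this⟩ := prmF_neg H b i β this
    rw [h2]
    change (rootSystem H).root ((rootSystem H).reflectionPerm i.1 β.1) = _
    rw [RootPairing.root_reflectionPerm, RootPairing.reflection_apply]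
    rfl
  cov_inj x hx := by
    refine b.toCoweightBasis.ext fun i => ?_
    have := hx i
    simpa using this
  root_ne β := (rootSystem H).ne_zero _

open scoped Classical in
lemma rd_conn (b : (rootSystem H).Base) [(rootSystem H).IsIrreducible] (T : Finset b.support)
    (hT : T.Nonempty) (hT' : T ≠ univ) : ∃ i ∈ T, ∃ j ∉ T, dyn (rdOf H b).A i j := by
  by_contra! hc
  obtain ⟨i, hi⟩ := hT
  apply hT'
  rw [Finset.eq_univ_iff_forall]
  intro j
  refine RootPairing.Base.induction_on_cartanMatrix b (fun i => i ∈ T) hi ?_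
  intro k l hk hkl
  by_contra hl
  refine hc k hk l hl ⟨?_, ?_⟩
  · rintro rfl; exact hl hk
  · exact hkl

end rd
end RajanAux

set_option linter.unusedSectionVars false
namespace RajanAux
open Finset LieAlgebra LieAlgebra.IsKilling Module
open scoped TensorProduct
section wts
variable {𝔤 : Type} [LieRing 𝔤] [LieAlgebra ℂ 𝔤]
  (H : LieSubalgebra ℂ 𝔤)
  (M : Type) [AddCommGroup M] [Module ℂ M] [LieRingModule 𝔤 M] [LieModule ℂ 𝔤 M]
  (N : Type) [AddCommGroup N] [Module ℂ N] [LieRingModule 𝔤 N] [LieModule ℂ 𝔤 N]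

/-- weight space (true simultaneous eigenvectors) -/
def ws (μ : Dual ℂ H) : Submodule ℂ M where
  carrier := {v | ∀ h : H, ⁅(h : 𝔤), v⁆ = μ h • v}
  add_mem' {a b} ha hb h := by rw [lie_add, ha h, hb h, smul_add]
  zero_mem' h := by simp
  smul_mem' c x hx h := by rw [lie_smul, hx h, smul_comm]

variable {H M N} in
lemma mem_ws {μ : Dual ℂ H} {v : M} : v ∈ ws H M μ ↔ ∀ h : H, ⁅(h : 𝔤), v⁆ = μ h • v := Iff.rfl

lemma ws_indep [LieRing.IsNilpotent H] : iSupIndep (ws H M) := by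
  have h1 := LieModule.iSupIndep_genWeightSpace ℂ H M
  rw [← LieSubmodule.iSupIndep_toSubmodule] at h1
  have h2 := h1.comp (f := fun μ : Dual ℂ H => (μ : H → ℂ)) DFunLike.coe_injective
  refine h2.mono fun μ => ?_
  intro v hv
  refine LieModule.weightSpace_le_genWeightSpace M _ ?_
  rw [LieModule.mem_weightSpace]
  exact hv

variable {H M N} in
lemma shift_ws {μ ν : Dual ℂ H} {x : 𝔤} (hx : ∀ h : H, ⁅(h : 𝔤), x⁆ = ν h • x) {v : M}
    (hv : v ∈ ws H M μ) : ⁅x, v⁆ ∈ ws H M (μ + ν) := by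
  intro h
  rw [leibniz_lie, hx, hv h, smul_lie, lie_smul, ← add_smul, LinearMap.add_apply, add_comm]

/-- `b` is a basis of weight vectors -/
def WB {κ : Type} (b : Basis κ ℂ M) (w : κ → Dual ℂ H) : Prop := ∀ k, b k ∈ ws H M (w k)

lemma exists_WB [LieRing.IsNilpotent H] [FiniteDimensional ℂ M] (h : ⨆ μ, ws H M μ = ⊤) :
    ∃ (κ : Type) (_ : Fintype κ) (b : Basis κ ℂ M) (w : κ → Dual ℂ H), WB H M b w := by
  classical
  have hi := DirectSum.isInternal_submodule_of_iSupIndep_of_iSup_eq_top (ws_indep H M) h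
  let b := hi.collectedBasis (fun μ => Module.finBasis ℂ (ws H M μ))
  refine ⟨_, FiniteDimensional.fintypeBasisIndex b, b, fun k => k.1, fun k => ?_⟩
  exact hi.collectedBasis_mem _ k

variable {H M N}

lemma WB.repr_eq_zero {κ : Type} {b : Basis κ ℂ M} {w : κ → Dual ℂ H} (hb : WB H M b w)
    {μ : Dual ℂ H} {v : M} (hv : v ∈ ws H M μ) {k : κ} (hk : w k ≠ μ) : b.repr v k = 0 := by
  obtain ⟨h, hh⟩ : ∃ h, w k h ≠ μ h := by
    by_contra! hc
    exact hk (LinearMap.ext hc)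
  have key : ∀ u : M, b.repr ⁅(h : 𝔤), u⁆ k = w k h * b.repr u k := by
    intro u
    have hu : u ∈ Submodule.span ℂ (Set.range b) := by rw [b.span_eq]; trivial
    induction hu using Submodule.span_induction with
    | zero => simp
    | mem x hx =>
      obtain ⟨i, rfl⟩ := hx
      rw [hb i h]
      by_cases hik : i = k
      · subst hik; simp
      · simp [Finsupp.single_apply, hik]
    | add x y _ _ hx hy => simp [hx, hy, mul_add]
    | smul c x _ hx => simp [hx]; ring
  have := key v
  rw [hv h] at this
  simp only [map_smul, Finsupp.smul_apply, smul_eq_mul] at this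
  have h3 : (w k h - μ h) * b.repr v k = 0 := by rw [sub_mul, ← this, sub_self]
  exact (mul_eq_zero.mp h3).resolve_left (sub_ne_zero.mpr hh)

lemma WB.finrank {κ : Type} [Fintype κ] [DecidableEq (Dual ℂ H)] {b : Basis κ ℂ M}
    {w : κ → Dual ℂ H} (hb : WB H M b w)
    (μ : Dual ℂ H) : Module.finrank ℂ (ws H M μ) = Fintype.card {k // w k = μ} := by
  have h1 : ws H M μ = Submodule.span ℂ (Set.range fun k : {k // w k = μ} => b k) := by
    apply le_antisymm
    · intro v hv
      rw [← b.sum_repr v]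
      refine Submodule.sum_mem _ fun k _ => ?_
      by_cases hk : w k = μ
      · exact Submodule.smul_mem _ _ (Submodule.subset_span ⟨⟨k, hk⟩, rfl⟩)
      · rw [hb.repr_eq_zero hv hk, zero_smul]; exact zero_mem _
    · rw [Submodule.span_le]
      rintro _ ⟨⟨k, rfl⟩, rfl⟩
      exact hb k
  rw [h1]
  exact finrank_span_eq_card (b.linearIndependent.comp _ Subtype.val_injective)

variable (H M N)

/-- formal character -/
noncomputable def ch [LieRing.IsNilpotent H] [FiniteDimensional ℂ M] : GA (Dual ℂ H) :=
  AddMonoidAlgebra.ofCoeff (Finsupp.ofSupportFinite (fun μ => (Module.finrank ℂ (ws H M μ) : ℂ)) (by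
    refine (WellFoundedGT.finite_ne_bot_of_iSupIndep (ws_indep H M)).subset ?_
    intro μ hμ h
    apply hμ
    simp [h]))

lemma ch_coeff [LieRing.IsNilpotent H] [FiniteDimensional ℂ M] (μ : Dual ℂ H) :
    (ch H M).coeff μ = (Module.finrank ℂ (ws H M μ) : ℂ) := rfl

variable {H M N}

lemma WB.ch [LieRing.IsNilpotent H] [FiniteDimensional ℂ M] {κ : Type} [Fintype κ]
    {b : Basis κ ℂ M} {w : κ → Dual ℂ H} (hb : WB H M b w) : ch H M = ∑ k, ee (w k) := by
  classical
  apply ga_ext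
  intro μ
  rw [ch_coeff, hb.finrank, Fintype.card_subtype]
  have : (∑ k, ee (w k)).coeff μ = ∑ k, (ee (w k)).coeff μ := by
    rw [AddMonoidAlgebra.coeff_sum, Finsupp.finsetSum_apply]
  rw [this, Finset.card_filter]
  push_cast
  refine Finset.sum_congr rfl fun k _ => ?_
  simp [ee, Finsupp.single_apply]

lemma WB.tensor {κ κ' : Type} {b : Basis κ ℂ M} {w : κ → Dual ℂ H} (hb : WB H M b w)
    {b' : Basis κ' ℂ N} {w' : κ' → Dual ℂ H} (hb' : WB H N b' w') :
    WB H (M ⊗[ℂ] N) (b.tensorProduct b') (fun p => w p.1 + w' p.2) := by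
  intro p h
  rw [Basis.tensorProduct_apply', TensorProduct.LieModule.lie_tmul_right, hb, hb',
    ← TensorProduct.smul_tmul', TensorProduct.tmul_smul, ← add_smul]
  rfl

lemma WB.top {κ : Type} {b : Basis κ ℂ M} {w : κ → Dual ℂ H} (hb : WB H M b w) :
    ⨆ μ, ws H M μ = ⊤ := by
  rw [eq_top_iff, ← b.span_eq, Submodule.span_le]
  rintro _ ⟨k, rfl⟩
  exact Submodule.mem_iSup_of_mem _ (hb k)

lemma diag_tensor [LieRing.IsNilpotent H] [FiniteDimensional ℂ M] [FiniteDimensional ℂ N]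
    (hM : ⨆ μ, ws H M μ = ⊤) (hN : ⨆ μ, ws H N μ = ⊤) :
    ⨆ μ, ws H (M ⊗[ℂ] N) μ = ⊤ := by
  obtain ⟨κ, _, b, w, hb⟩ := exists_WB H M hM
  obtain ⟨κ', _, b', w', hb'⟩ := exists_WB H N hN
  exact (hb.tensor hb').top

lemma ch_tensor [LieRing.IsNilpotent H] [FiniteDimensional ℂ M] [FiniteDimensional ℂ N]
    (hM : ⨆ μ, ws H M μ = ⊤) (hN : ⨆ μ, ws H N μ = ⊤) :
    ch H (M ⊗[ℂ] N) = ch H M * ch H N := by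
  obtain ⟨κ, _, b, w, hb⟩ := exists_WB H M hM
  obtain ⟨κ', _, b', w', hb'⟩ := exists_WB H N hN
  rw [hb.ch, hb'.ch, (hb.tensor hb').ch, Finset.sum_mul_sum, Fintype.sum_prod_type]
  refine Finset.sum_congr rfl fun k _ => Finset.sum_congr rfl fun l _ => ?_
  rw [ee_mul]

lemma ch_congr [LieRing.IsNilpotent H] [FiniteDimensional ℂ M] [FiniteDimensional ℂ N]
    (φ : M ≃ₗ⁅ℂ,𝔤⁆ N) : ch H M = ch H N := by
  apply ga_ext
  intro μ
  rw [ch_coeff, ch_coeff]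
  congr 1
  have : (ws H M μ).map (φ.toLinearEquiv : M →ₗ[ℂ] N) = ws H N μ := by
    ext v
    rw [Submodule.mem_map]
    constructor
    · rintro ⟨u, hu, rfl⟩ h
      have h1 := congrArg φ.toLieModuleHom (hu h)
      rw [LieModuleHom.map_lie, map_smul] at h1
      exact h1
    · intro hv
      refine ⟨φ.symm v, fun h => ?_, φ.apply_symm_apply v⟩
      have h1 := congrArg φ.symm.toLieModuleHom (hv h)
      rw [LieModuleHom.map_lie, map_smul] at h1
      exact h1
  rw [← this]
  exact (LinearEquiv.finrank_map_eq φ.toLinearEquiv _).symm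

end wts
end RajanAux

set_option linter.unusedSectionVars false
namespace RajanAux
open Finset LieAlgebra LieAlgebra.IsKilling Module
section cd
variable {𝔤 : Type} [LieRing 𝔤] [LieAlgebra ℂ 𝔤] [FiniteDimensional ℂ 𝔤] [IsKilling ℂ 𝔤]
  (H : LieSubalgebra ℂ 𝔤) [H.IsCartanSubalgebra] (b : (rootSystem H).Base)

/-- the type of positive roots -/
abbrev PR := {a : H.root // b.IsPos a}

/-- root as functional -/
noncomputable def rt {b : (rootSystem H).Base} (β : PR H b) : Dual ℂ H := (rootSystem H).root β.1

/-- Normalised root vectors. -/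
structure CD where
  e : PR H b → 𝔤
  f : PR H b → 𝔤
  he : ∀ β (h : H), ⁅(h : 𝔤), e β⁆ = rt H β h • e β
  hf : ∀ β (h : H), ⁅(h : 𝔤), f β⁆ = (-rt H β) h • f β
  hef : ∀ β, ⁅e β, f β⁆ = (tt H (rt H β) : 𝔤)
  kef : ∀ β, killingForm ℂ 𝔤 (e β) (f β) = 1
  kef' : ∀ β γ, β ≠ γ → killingForm ℂ 𝔤 (e β) (f γ) = 0
  kee : ∀ β γ, killingForm ℂ 𝔤 (e β) (e γ) = 0
  kff : ∀ β γ, killingForm ℂ 𝔤 (f β) (f γ) = 0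
  khe : ∀ (h : H) γ, killingForm ℂ 𝔤 (h : 𝔤) (e γ) = 0
  khf : ∀ (h : H) γ, killingForm ℂ 𝔤 (h : 𝔤) (f γ) = 0
  span : H.toSubmodule ⊔ (Submodule.span ℂ (Set.range e) ⊔ Submodule.span ℂ (Set.range f)) = ⊤

lemma rt_add_ne (β γ : PR H b) : rt H β + rt H γ ≠ 0 := by
  intro h
  have h1 : (rootSystem H).root γ.1 = (rootSystem H).root
      ((rootSystem H).reflectionPerm β.1 β.1) := by
    rw [RootPairing.root_reflectionPerm, RootPairing.reflection_apply_self]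
    exact eq_neg_of_add_eq_zero_right h
  have h2 := (rootSystem H).root.injective h1
  have h3 := (RootPairing.Base.IsPos.neg_iff_not (b := b) β.1).mp (by
    have := γ.2
    rw [h2] at this
    exact this)
  exact h3 β.2

lemma exists_ef (a : H.root) : ∃ e f : 𝔤, e ∈ rootSpace H a.1 ∧ f ∈ rootSpace H (-(a.1 : H → ℂ)) ∧
    killingForm ℂ 𝔤 e f = 1 := by
  obtain ⟨x, hx, hx0⟩ := a.1.exists_ne_zero
  by_contra! hc
  apply hx0
  have := mem_ker_killingForm_of_mem_rootSpace_of_forall_rootSpace_neg ℂ 𝔤 H hx (by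
    intro y hy
    by_contra h0
    refine hc x ((killingForm ℂ 𝔤 x y)⁻¹ • y) hx (Submodule.smul_mem _ _ hy) ?_
    rw [map_smul, smul_eq_mul, inv_mul_cancel₀ h0])
  rw [ker_killingForm_eq_bot] at this
  simpa using this

lemma mem_span_of_rootSpace (a : LieModule.Weight ℂ H 𝔤) (ha : a.IsNonZero) {x y : 𝔤}
    (hx : x ∈ rootSpace H a) (hx0 : x ≠ 0) (hy : y ∈ rootSpace H a) : ∃ c : ℂ, y = c • x := by
  have h1 := finrank_rootSpace_eq_one a ha
  obtain ⟨c, hc⟩ := (finrank_eq_one_iff_of_nonzero' (⟨x, hx⟩ : rootSpace H a)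
    (by simpa [Subtype.ext_iff] using hx0)).mp h1 ⟨y, hy⟩
  exact ⟨c, (congrArg Subtype.val hc).symm⟩

theorem exists_CD : Nonempty (CD H b) := by
  choose e f he hf hk using exists_ef H
  have hH : ∀ h : H, (h : 𝔤) ∈ rootSpace H (0 : H → ℂ) := by
    intro h
    rw [rootSpace_zero_eq]
    exact h.2
  have hrt : ∀ β : PR H b, ((rt H β : Dual ℂ H) : H → ℂ) = (β.1.1 : H → ℂ) := by
    intro β
    rfl
  have e0 : ∀ a, e a ≠ 0 := by
    intro a h; have := hk a; rw [h] at this; simp at this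
  have f0 : ∀ a, f a ≠ 0 := by
    intro a h; have := hk a; rw [h] at this; simp at this
  refine ⟨{ e := fun β => e β.1, f := fun β => f β.1, he := ?_, hf := ?_, hef := ?_, kef := ?_,
            kef' := ?_, kee := ?_, kff := ?_, khe := ?_, khf := ?_, span := ?_ }⟩
  · intro β h
    exact lie_eq_smul_of_mem_rootSpace (he β.1) h
  · intro β h
    exact lie_eq_smul_of_mem_rootSpace (hf β.1) h
  · intro β
    rw [lie_eq_killingForm_smul_of_mem_rootSpace_of_mem_rootSpace_neg (he β.1) (hf β.1), hk,
      one_smul]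
    rfl
  · intro β; exact hk β.1
  · intro β γ hne
    refine killingForm_apply_eq_zero_of_mem_rootSpace_of_add_ne_zero ℂ 𝔤 H (he β.1) (hf γ.1) ?_
    intro h
    apply hne
    apply Subtype.ext
    apply (rootSystem H).root.injective
    have h2 : (rt H β : H → ℂ) = rt H γ := by
      rw [hrt, hrt]; rw [← sub_eq_add_neg] at h; exact sub_eq_zero.mp h
    exact DFunLike.coe_injective h2
  · intro β γ
    refine killingForm_apply_eq_zero_of_mem_rootSpace_of_add_ne_zero ℂ 𝔤 H (he β.1) (he γ.1) ?_
    intro h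
    exact rt_add_ne H b β γ (DFunLike.coe_injective h)
  · intro β γ
    refine killingForm_apply_eq_zero_of_mem_rootSpace_of_add_ne_zero ℂ 𝔤 H (hf β.1) (hf γ.1) ?_
    intro h
    refine rt_add_ne H b β γ (DFunLike.coe_injective ?_)
    have h3 := congrArg (fun z => -z) h
    simp only [neg_add, neg_neg, neg_zero] at h3
    exact h3
  · intro h γ
    refine killingForm_apply_eq_zero_of_mem_rootSpace_of_add_ne_zero ℂ 𝔤 H (hH h) (he γ.1) ?_
    rw [zero_add]
    exact nonzero_of_root H γ.1
  · intro h γ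
    refine killingForm_apply_eq_zero_of_mem_rootSpace_of_add_ne_zero ℂ 𝔤 H (hH h) (hf γ.1) ?_
    rw [zero_add, neg_ne_zero]
    exact nonzero_of_root H γ.1
  · have h1 := cartan_sup_iSup_rootSpace_eq_top (K := ℂ) H
    rw [← LieSubmodule.toSubmodule_inj] at h1
    simp only [LieSubmodule.sup_toSubmodule, LieSubmodule.iSup_toSubmodule,
      LieSubmodule.top_toSubmodule] at h1
    rw [eq_top_iff, ← h1]
    refine sup_le ?_ (iSup_le fun a => iSup_le fun ha => ?_)
    · exact le_sup_left
    · refine le_trans ?_ le_sup_right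
      intro y hy
      let a' : H.root := ⟨a, by simpa using ha⟩
      rcases RootPairing.Base.IsPos.or_neg b a' with h | h
      · obtain ⟨c, rfl⟩ := mem_span_of_rootSpace H a ha (he a') (e0 a') hy
        exact Submodule.mem_sup_left (Submodule.smul_mem _ _ (Submodule.subset_span ⟨⟨a', h⟩, rfl⟩))
      · set a'' : H.root := (rootSystem H).reflectionPerm a' a' with ha''
        have h5 : (a''.1 : H → ℂ) = - (a : H → ℂ) := by
          have : (rootSystem H).root a'' = - (rootSystem H).root a' := by
            rw [RootPairing.root_reflectionPerm, RootPairing.reflection_apply_self]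
          exact congrArg (fun z : Dual ℂ H => (z : H → ℂ)) this
        have h6 : f a'' ∈ rootSpace H a := by
          have := hf a''
          rwa [h5, neg_neg] at this
        obtain ⟨c, rfl⟩ := mem_span_of_rootSpace H a ha h6 (f0 a'') hy
        exact Submodule.mem_sup_right (Submodule.smul_mem _ _ (Submodule.subset_span ⟨⟨a'', h⟩, rfl⟩))

variable {H b}

/-- induction principle for elements of `𝔤`. -/
lemma CD.induction (D : CD H b) (S : Submodule ℂ 𝔤) (h1 : ∀ h : H, (h : 𝔤) ∈ S)
    (h2 : ∀ β, D.e β ∈ S) (h3 : ∀ β, D.f β ∈ S) (x : 𝔤) : x ∈ S := by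
  have : (⊤ : Submodule ℂ 𝔤) ≤ S := by
    rw [← D.span]
    refine sup_le (fun x hx => h1 ⟨x, hx⟩) (sup_le ?_ ?_)
    · rw [Submodule.span_le]; rintro _ ⟨β, rfl⟩; exact h2 β
    · rw [Submodule.span_le]; rintro _ ⟨β, rfl⟩; exact h3 β
  exact this trivial

end cd
end RajanAux

set_option linter.unusedSectionVars false
namespace RajanAux
open Finset LieAlgebra LieAlgebra.IsKilling Module
open scoped TensorProduct
section cas
variable {𝔤 : Type} [LieRing 𝔤] [LieAlgebra ℂ 𝔤] [FiniteDimensional ℂ 𝔤] [IsKilling ℂ 𝔤]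
  {M : Type} [AddCommGroup M] [Module ℂ M] [LieRingModule 𝔤 M] [LieModule ℂ 𝔤 M]

lemma tensor_eq_zero {κ : Type} [Fintype κ] (a b : κ → 𝔤)
    (h : ∀ y, ∑ i, killingForm ℂ 𝔤 (a i) y • b i = y) (x : 𝔤) :
    ∑ i, (⁅x, a i⁆ ⊗ₜ[ℂ] b i + a i ⊗ₜ[ℂ] ⁅x, b i⁆) = 0 := by
  have hinj : Function.Injective (LinearMap.rTensor 𝔤 (killingForm ℂ 𝔤)) := by
    apply Module.Flat.rTensor_preserves_injective_linearMap
    rw [← LinearMap.ker_eq_bot]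
    exact ker_killingForm_eq_bot ℂ 𝔤
  apply hinj
  apply (dualTensorHomEquiv ℂ 𝔤 𝔤).injective
  rw [map_zero, map_zero]
  ext y
  have hk : ∀ i, killingForm ℂ 𝔤 ⁅x, a i⁆ y = - killingForm ℂ 𝔤 (a i) ⁅x, y⁆ := by
    intro i
    rw [← lie_skew, map_neg, LinearMap.neg_apply]
    exact congrArg _ (LieModule.traceForm_apply_lie_apply ℂ 𝔤 𝔤 _ _ _)
  simp only [map_sum, map_add, LinearMap.rTensor_tmul, dualTensorHomEquiv,
    LinearEquiv.ofBijective_apply, LinearMap.sum_apply, LinearMap.add_apply, dualTensorHom_apply,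
    LinearMap.zero_apply, hk, neg_smul]
  rw [Finset.sum_add_distrib, Finset.sum_neg_distrib, h]
  have := congrArg (fun z => ⁅x, z⁆) (h y)
  simp only [lie_sum, lie_smul] at this
  rw [this, neg_add_cancel]

lemma cas_comm {κ : Type} [Fintype κ] (a b : κ → 𝔤)
    (h : ∀ y, ∑ i, killingForm ℂ 𝔤 (a i) y • b i = y) (x : 𝔤) (v : M) :
    ⁅x, ∑ i, ⁅a i, ⁅b i, v⁆⁆⁆ = ∑ i, ⁅a i, ⁅b i, ⁅x, v⁆⁆⁆ := by
  let L : 𝔤 ⊗[ℂ] 𝔤 →ₗ[ℂ] M := TensorProduct.lift (LinearMap.mk₂ ℂ (fun a b : 𝔤 => ⁅a, ⁅b, v⁆⁆)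
    (by simp) (by simp) (by simp) (by simp))
  have h1 := congrArg L (tensor_eq_zero a b h x)
  simp only [map_sum, map_add, map_zero, L, TensorProduct.lift.tmul, LinearMap.mk₂_apply] at h1
  rw [← sub_eq_zero, lie_sum, ← Finset.sum_sub_distrib, ← h1]
  refine Finset.sum_congr rfl fun i _ => ?_
  rw [leibniz_lie x (a i), leibniz_lie x (b i) v, lie_add]
  abel

end cas

section hw
variable {𝔤 : Type} [LieRing 𝔤] [LieAlgebra ℂ 𝔤] [FiniteDimensional ℂ 𝔤] [IsKilling ℂ 𝔤]
  {H : LieSubalgebra ℂ 𝔤} [H.IsCartanSubalgebra] {b : (rootSystem H).Base} (D : CD H b)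
  {M : Type} [AddCommGroup M] [Module ℂ M] [LieRingModule 𝔤 M] [LieModule ℂ 𝔤 M]
  {N : Type} [AddCommGroup N] [Module ℂ N] [LieRingModule 𝔤 N] [LieModule ℂ 𝔤 N]

open scoped Classical in
variable (b) in
/-- positivity functional -/
noncomputable def pf (x : Dual ℂ H) : ℝ := (dB H x (rdOf H b).ρ).re

lemma pf_add (x y : Dual ℂ H) : pf b (x + y) = pf b x + pf b y := by simp [pf]

lemma pf_pos (β : PR H b) : 0 < pf b (rt H β) := by
  classical
  obtain ⟨k, hk⟩ := (rdOf H b).pos β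
  have h1 : ∀ i, dB H ((rdOf H b).root ((rdOf H b).simple i)) (rdOf H b).ρ = (rdOf H b).d i := by
    intro i
    have := (rdOf H b).hB i (rdOf H b).ρ
    rw [(rdOf H b).cov_ρ, mul_one] at this
    exact this
  have h2 : pf b (rt H β) = ∑ i, k i * (rdOf H b).d i := by
    have h3 : rt H β = (rdOf H b).root β := rfl
    rw [pf, h3, hk, map_sum, LinearMap.sum_apply]
    simp only [map_nsmul, LinearMap.smul_apply, h1]
    simp
  rw [h2]
  have hne : ∃ i, k i ≠ 0 := by
    by_contra! hc
    apply (rdOf H b).root_ne β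
    rw [hk]
    simp [hc]
  obtain ⟨i, hi⟩ := hne
  refine Finset.sum_pos' (fun j _ => ?_) ⟨i, Finset.mem_univ _, ?_⟩
  · have := (rdOf H b).dpos j; positivity
  · have := (rdOf H b).dpos i
    have : 0 < k i := Nat.pos_of_ne_zero hi
    positivity

variable (b) in
/-- the positive cone -/
def cone : AddSubmonoid (Dual ℂ H) := AddSubmonoid.closure (Set.range (rt H (b := b)))

lemma pf_cone {x : Dual ℂ H} (hx : x ∈ cone b) : 0 ≤ pf b x := by
  induction hx using AddSubmonoid.closure_induction with
  | mem x hx => obtain ⟨β, rfl⟩ := hx; exact (pf_pos β).le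
  | zero => simp [pf]
  | add x y _ _ hx hy => rw [pf_add]; positivity

lemma rt_cone (β : PR H b) : rt H β ∈ cone b := AddSubmonoid.subset_closure ⟨β, rfl⟩

lemma cone_add_ne {x : Dual ℂ H} (hx : x ∈ cone b) (β : PR H b) : x + rt H β ≠ 0 := by
  intro h
  have h1 := pf_add (b := b) x (rt H β)
  rw [h] at h1
  have := pf_cone hx
  have h2 := pf_pos β
  simp [pf] at h1
  unfold pf at *
  linarith

/-- highest weight vectors -/
structure HW (D : CD H b) (v : M) (lam : Dual ℂ H) : Prop where
  ne : v ≠ 0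
  mem : v ∈ ws H M lam
  kill : ∀ β, ⁅D.e β, v⁆ = 0

/-- the smallest subspace containing `v` and stable under the `f`'s. -/
def gen (v : M) : Submodule ℂ M :=
  sInf {S | v ∈ S ∧ ∀ β, ∀ w ∈ S, ⁅D.f β, w⁆ ∈ S}

variable {D}

lemma gen_le {v : M} {S : Submodule ℂ M} (h1 : v ∈ S) (h2 : ∀ β, ∀ w ∈ S, ⁅D.f β, w⁆ ∈ S) :
    gen D v ≤ S := sInf_le ⟨h1, h2⟩

lemma mem_gen (v : M) : v ∈ gen D v := by
  rw [gen, Submodule.mem_sInf]; intro S hS; exact hS.1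

lemma f_gen (v : M) (β) {w : M} (hw : w ∈ gen D v) : ⁅D.f β, w⁆ ∈ gen D v := by
  rw [gen, Submodule.mem_sInf] at *
  intro S hS; exact hS.2 β w (hw S hS)

lemma HW.lie_gen {v : M} {lam : Dual ℂ H} (h : HW D v lam) {w : M} (hw : w ∈ gen D v) (x : 𝔤) :
    ⁅x, w⁆ ∈ gen D v := by
  let S : Submodule ℂ M :=
    { carrier := {w | w ∈ gen D v ∧ ∀ x : 𝔤, ⁅x, w⁆ ∈ gen D v}
      add_mem' := fun {a c} ha hc => ⟨add_mem ha.1 hc.1, fun x => by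
        rw [lie_add]; exact add_mem (ha.2 x) (hc.2 x)⟩
      zero_mem' := ⟨zero_mem _, fun x => by rw [lie_zero]; exact zero_mem _⟩
      smul_mem' := fun c a ha => ⟨Submodule.smul_mem _ _ ha.1, fun x => by
        rw [lie_smul]; exact Submodule.smul_mem _ _ (ha.2 x)⟩ }
  have hS : gen D v ≤ S := by
    apply gen_le
    · refine ⟨mem_gen v, fun x => ?_⟩
      let T : Submodule ℂ 𝔤 := (gen D v).comap
        ((LieModule.toEnd ℂ 𝔤 M : 𝔤 →ₗ[ℂ] Module.End ℂ M).flip v)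
      refine D.induction T ?_ ?_ ?_ x
      · intro y
        change ⁅(y : 𝔤), v⁆ ∈ gen D v
        rw [h.mem y]; exact Submodule.smul_mem _ _ (mem_gen v)
      · intro β
        change ⁅D.e β, v⁆ ∈ gen D v
        rw [h.kill]; exact zero_mem _
      · intro β
        exact f_gen v β (mem_gen v)
    · intro β w hw
      refine ⟨f_gen v β hw.1, fun x => ?_⟩
      rw [leibniz_lie]
      exact add_mem (hw.2 _) (f_gen v β (hw.2 x))
  exact (hS hw).2 x

/-- the Lie submodule generated by a highest weight vector -/
def HW.sub {v : M} {lam : Dual ℂ H} (h : HW D v lam) : LieSubmodule ℂ 𝔤 M :=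
  { gen D v with lie_mem := fun hw => h.lie_gen hw _ }

lemma HW.mem_sub {v : M} {lam : Dual ℂ H} (h : HW D v lam) {w : M} : w ∈ h.sub ↔ w ∈ gen D v :=
  Iff.rfl

lemma HW.gen_le' {v : M} {lam : Dual ℂ H} (h : HW D v lam) :
    gen D v ≤ Submodule.span ℂ {v} ⊔
      ⨆ μ : {μ : Dual ℂ H // μ ∈ cone b ∧ μ ≠ 0}, ws H M (lam - μ.1) := by
  apply gen_le
  · exact Submodule.mem_sup_left (Submodule.mem_span_singleton_self v)
  · intro β w hw
    let φ : M →ₗ[ℂ] M := LieModule.toEnd ℂ 𝔤 M (D.f β)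
    have key : (Submodule.span ℂ {v} ⊔
      ⨆ μ : {μ : Dual ℂ H // μ ∈ cone b ∧ μ ≠ 0}, ws H M (lam - μ.1)).map φ ≤
        ⨆ μ : {μ : Dual ℂ H // μ ∈ cone b ∧ μ ≠ 0}, ws H M (lam - μ.1) := by
      have aux : ∀ x ∈ cone b, ∀ u ∈ ws H M (lam - x), φ u ∈
          ⨆ μ : {μ : Dual ℂ H // μ ∈ cone b ∧ μ ≠ 0}, ws H M (lam - μ.1) := by
        intro x hx u hu
        have h1 := shift_ws (D.hf β) hu
        refine Submodule.mem_iSup_of_mem ⟨x + rt H β, add_mem hx (rt_cone β), cone_add_ne hx β⟩ ?_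
        have h2 : lam - x + -rt H β = lam - (x + rt H β) := by abel
        rw [h2] at h1
        exact h1
      rw [Submodule.map_sup, Submodule.map_iSup]
      refine sup_le ?_ (iSup_le fun μ => ?_)
      · rw [Submodule.map_span, Submodule.span_le]
        rintro _ ⟨_, rfl, rfl⟩
        refine aux 0 (zero_mem _) _ ?_
        rw [sub_zero]; exact h.mem
      · rintro _ ⟨u, hu, rfl⟩
        exact aux _ μ.2.1 _ hu
    exact Submodule.mem_sup_right (key ⟨w, hw, rfl⟩)

lemma HW.gen_top {v : M} {lam : Dual ℂ H} (h : HW D v lam) {w : M} (hw : w ∈ gen D v)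
    (hw' : w ∈ ws H M lam) : ∃ c : ℂ, w = c • v := by
  have h1 := h.gen_le' hw
  obtain ⟨y, hy, z, hz, rfl⟩ := Submodule.mem_sup.mp h1
  obtain ⟨c, rfl⟩ := Submodule.mem_span_singleton.mp hy
  refine ⟨c, ?_⟩
  have h2 : z ∈ ws H M lam := by
    have := sub_mem hw' (Submodule.smul_mem (ws H M lam) c h.mem)
    rwa [add_sub_cancel_left] at this
  have h3 := ws_indep H M lam
  rw [Submodule.disjoint_def] at h3
  have h4 := h3 z h2 (by
    refine (iSup_le fun μ => ?_ : (⨆ μ : {μ : Dual ℂ H // μ ∈ cone b ∧ μ ≠ 0},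
      ws H M (lam - μ.1)) ≤ _) hz
    refine le_iSup₂_of_le (lam - μ.1) ?_ le_rfl
    intro h; exact μ.2.2 (by simpa using h))
  rw [h4, add_zero]

/-- irreducible modules are generated by any highest weight vector -/
lemma HW.gen_eq_top [LieModule.IsIrreducible ℂ 𝔤 M] {v : M} {lam : Dual ℂ H} (h : HW D v lam) :
    gen D v = ⊤ := by
  have h1 : h.sub ≠ ⊥ := by
    intro h0
    have := (h.mem_sub).mpr (mem_gen (D := D) v)
    rw [h0] at this
    exact h.ne (by simpa using this)
  have h2 := (IsSimpleOrder.eq_bot_or_eq_top h.sub).resolve_left h1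
  rw [eq_top_iff]
  intro w _
  rw [← h.mem_sub, h2]
  trivial

lemma HW.supp [LieModule.IsIrreducible ℂ 𝔤 M] {v : M} {lam : Dual ℂ H} (h : HW D v lam)
    {μ : Dual ℂ H} (hμ : ws H M μ ≠ ⊥) : ∃ x ∈ cone b, μ = lam - x := by
  by_contra! hc
  apply hμ
  rw [eq_bot_iff]
  intro w hw
  have h1 := h.gen_le' (h.gen_eq_top ▸ Submodule.mem_top : w ∈ gen D v)
  have h3 := ws_indep H M μ
  rw [Submodule.disjoint_def] at h3
  refine h3 w hw ?_
  refine (sup_le ?_ (iSup_le fun x => ?_) : Submodule.span ℂ {v} ⊔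
      (⨆ μ : {μ : Dual ℂ H // μ ∈ cone b ∧ μ ≠ 0}, ws H M (lam - μ.1)) ≤ _) h1
  · rw [Submodule.span_le]
    rintro _ rfl
    refine Submodule.mem_iSup_of_mem lam (Submodule.mem_iSup_of_mem ?_ h.mem)
    intro h0
    exact hc 0 (zero_mem _) (by rw [sub_zero, h0])
  · refine le_iSup₂_of_le (lam - x.1) ?_ le_rfl
    intro h0; exact hc _ x.2.1 h0.symm

lemma HW.finrank_top [LieModule.IsIrreducible ℂ 𝔤 M] {v : M} {lam : Dual ℂ H} (h : HW D v lam) :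
    Module.finrank ℂ (ws H M lam) = 1 := by
  rw [finrank_eq_one_iff_of_nonzero' (⟨v, h.mem⟩ : ws H M lam)
    (fun h0 => h.ne (congrArg Subtype.val h0))]
  rintro ⟨w, hw⟩
  obtain ⟨c, hc⟩ := h.gen_top (h.gen_eq_top ▸ Submodule.mem_top : w ∈ gen D v) hw
  exact ⟨c, Subtype.ext hc.symm⟩

end hw
end RajanAux

set_option linter.unusedSectionVars false
namespace RajanAux
open Finset LieAlgebra LieAlgebra.IsKilling Module
open scoped TensorProduct

section sl2
variable {𝔤 : Type} [LieRing 𝔤] [LieAlgebra ℂ 𝔤]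
  {M : Type} [AddCommGroup M] [Module ℂ M] [LieRingModule 𝔤 M] [LieModule ℂ 𝔤 M]

lemma sl2_comm {h e f : 𝔤} (t : IsSl2Triple h e f) (a : ℂ) (v : M) (hv : ⁅h, v⁆ = a • v) (k : ℕ) :
    ⁅h, ((LieModule.toEnd ℂ 𝔤 M e) ^ k) v⁆ = (a + 2 * k) • ((LieModule.toEnd ℂ 𝔤 M e) ^ k) v ∧
    ∃ c : ℂ, ((LieModule.toEnd ℂ 𝔤 M e) ^ (k + 1)) ⁅f, v⁆ =
      ⁅f, ((LieModule.toEnd ℂ 𝔤 M e) ^ (k + 1)) v⁆ + c • ((LieModule.toEnd ℂ 𝔤 M e) ^ k) v := by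
  induction k with
  | zero =>
    refine ⟨by simpa using hv, a, ?_⟩
    simp only [zero_add, pow_one, pow_zero, LieModule.toEnd_apply_apply, Module.End.one_apply]
    rw [leibniz_lie e f v, t.lie_e_f, hv, add_comm]
  | succ k ih =>
    obtain ⟨h1, c, hc⟩ := ih
    have h2 : ⁅h, ((LieModule.toEnd ℂ 𝔤 M e) ^ (k + 1)) v⁆ =
        (a + 2 * (k + 1 : ℕ)) • ((LieModule.toEnd ℂ 𝔤 M e) ^ (k + 1)) v := by
      rw [pow_succ', Module.End.mul_apply, LieModule.toEnd_apply_apply, leibniz_lie, h1,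
        t.lie_h_e_smul ℂ, lie_smul, smul_lie, ← add_smul]
      congr 1
      push_cast; ring
    refine ⟨h2, c + (a + 2 * (k + 1 : ℕ)), ?_⟩
    rw [pow_succ', Module.End.mul_apply, hc, Module.End.mul_apply, LieModule.toEnd_apply_apply,
      LieModule.toEnd_apply_apply, lie_add, leibniz_lie e f, t.lie_e_f, h2, lie_smul]
    have : ⁅e, ((LieModule.toEnd ℂ 𝔤 M e) ^ k) v⁆ = ((LieModule.toEnd ℂ 𝔤 M e) ^ (k + 1)) v := by
      rw [pow_succ', Module.End.mul_apply, LieModule.toEnd_apply_apply]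
    rw [this]
    module

lemma sl2_inj {h e f : 𝔤} (t : IsSl2Triple h e f) (r : ℕ) : ∀ (n : ℕ) (v : M),
    ⁅h, v⁆ = (-(n : ℂ)) • v → ((LieModule.toEnd ℂ 𝔤 M f) ^ r) v = 0 →
    ((LieModule.toEnd ℂ 𝔤 M e) ^ n) v = 0 → v = 0 := by
  induction r with
  | zero => intro n v _ h2 _; simpa using h2
  | succ r ih =>
    intro n v h1 h2 h3
    have h4 : ⁅f, v⁆ = 0 := by
      apply ih (n + 2)
      · rw [leibniz_lie, h1, t.lie_lie_smul_f ℂ, lie_smul, neg_lie, smul_lie, ← neg_smul,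
          ← add_smul]
        congr 1
        push_cast; ring
      · rw [pow_succ, Module.End.mul_apply, LieModule.toEnd_apply_apply] at h2
        exact h2
      · obtain ⟨_, c, hc⟩ := sl2_comm t _ v h1 (n + 1)
        rw [hc, pow_succ', pow_succ', Module.End.mul_apply, Module.End.mul_apply, h3]
        simp
    by_contra hv
    have P : t.symm.HasPrimitiveVectorWith v (n : ℂ) :=
      ⟨hv, by rw [neg_lie, h1, neg_smul, neg_neg], h4⟩
    exact P.pow_toEnd_f_ne_zero_of_eq_nat rfl le_rfl h3

lemma pow_shift {H : LieSubalgebra ℂ 𝔤} {e : 𝔤} {ν : Dual ℂ H}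
    (he : ∀ h : H, ⁅(h : 𝔤), e⁆ = ν h • e) {μ : Dual ℂ H} {v : M} (hv : v ∈ ws H M μ) (r : ℕ) :
    ((LieModule.toEnd ℂ 𝔤 M e) ^ r) v ∈ ws H M (μ + (r : ℂ) • ν) := by
  induction r with
  | zero => simpa using hv
  | succ r ih =>
    rw [pow_succ', Module.End.mul_apply, LieModule.toEnd_apply_apply]
    have := shift_ws he ih
    rw [add_assoc] at this
    convert this using 2
    push_cast
    rw [add_smul, one_smul]

lemma pow_zero_of_shift {H : LieSubalgebra ℂ 𝔤} [LieRing.IsNilpotent H] [FiniteDimensional ℂ M]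
    {e : 𝔤} {ν : Dual ℂ H} (hν : ν ≠ 0)
    (he : ∀ h : H, ⁅(h : 𝔤), e⁆ = ν h • e) {μ : Dual ℂ H} {v : M} (hv : v ∈ ws H M μ) :
    ∃ r : ℕ, ((LieModule.toEnd ℂ 𝔤 M e) ^ r) v = 0 := by
  by_contra! hc
  have h1 := WellFoundedGT.finite_ne_bot_of_iSupIndep (ws_indep H M)
  have h2 : Function.Injective (fun r : ℕ => μ + (r : ℂ) • ν) := by
    intro r s hrs
    have h3 := add_left_cancel hrs
    exact Nat.cast_injective (smul_left_injective ℂ hν h3)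
  refine Set.infinite_range_of_injective h2 (h1.subset ?_)
  rintro _ ⟨r, rfl⟩ h0
  have h3 := pow_shift he hv r
  rw [h0] at h3
  exact hc r (by simpa using h3)

lemma sl2_finrank_le {H : LieSubalgebra ℂ 𝔤} [LieRing.IsNilpotent H] [FiniteDimensional ℂ M]
    {h : H} {e f : 𝔤} (t : IsSl2Triple (h : 𝔤) e f) {ν : Dual ℂ H} (hν : ν ≠ 0)
    (he : ∀ h : H, ⁅(h : 𝔤), e⁆ = ν h • e) (hf : ∀ h : H, ⁅(h : 𝔤), f⁆ = (-ν) h • f)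
    {μ : Dual ℂ H} {n : ℕ} (hμ : μ h = -(n : ℂ)) :
    Module.finrank ℂ (ws H M μ) ≤ Module.finrank ℂ (ws H M (μ + (n : ℂ) • ν)) := by
  refine LinearMap.finrank_le_finrank_of_injective
    (f := ((LieModule.toEnd ℂ 𝔤 M e) ^ n).restrict (fun v hv => pow_shift he hv n)) ?_
  rw [← LinearMap.ker_eq_bot, LinearMap.ker_eq_bot']
  rintro ⟨v, hv⟩ h0
  obtain ⟨r, hr⟩ := pow_zero_of_shift (neg_ne_zero.mpr hν) hf hv
  apply Subtype.ext
  exact sl2_inj t r n v (by rw [hv h, hμ]) hr (congrArg Subtype.val h0)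
end sl2

section irr
variable {𝔤 : Type} [LieRing 𝔤] [LieAlgebra ℂ 𝔤] [FiniteDimensional ℂ 𝔤] [IsKilling ℂ 𝔤]
  {H : LieSubalgebra ℂ 𝔤} [H.IsCartanSubalgebra] {b : (rootSystem H).Base} (D : CD H b)
  {M : Type} [AddCommGroup M] [Module ℂ M] [LieRingModule 𝔤 M] [LieModule ℂ 𝔤 M]
  {N : Type} [AddCommGroup N] [Module ℂ N] [LieRingModule 𝔤 N] [LieModule ℂ 𝔤 N]

lemma rt_coroot (β : PR H b) : rt H β (coroot β.1.1) = 2 :=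
  root_apply_coroot (nonzero_of_root H β.1)

lemma rt_ne (β : PR H b) : rt H β ≠ 0 := (rootSystem H).ne_zero _

lemma CD.sl2 (β : PR H b) : IsSl2Triple ((coroot β.1.1 : H) : 𝔤) (D.e β)
    (((nrm H β.1 : ℂ) / 2) • D.f β) where
  h_ne_zero := by
    intro h
    have h1 := rt_coroot β
    have h2 : coroot β.1.1 = (0 : H) := Subtype.ext h
    rw [h2, map_zero] at h1
    norm_num at h1
  lie_e_f := by
    have h0 : (nrm H β.1 : ℂ) ≠ 0 := by exact_mod_cast (nrm_pos H β.1).ne'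
    rw [lie_smul, D.hef]
    have h2 : tt H (rt H β) = _ := tt_root H β.1
    rw [h2]
    change _ • ((2 / (nrm H β.1 : ℂ)) • ((coroot β.1.1 : H) : 𝔤)) = _
    rw [smul_smul]
    have h3 : (nrm H β.1 : ℂ) / 2 * (2 / nrm H β.1) = 1 := by field_simp
    rw [h3, one_smul]
  lie_h_e_nsmul := by
    rw [D.he, rt_coroot, ← Nat.cast_smul_eq_nsmul ℂ]; norm_num
  lie_h_f_nsmul := by
    rw [lie_smul, D.hf, LinearMap.neg_apply, rt_coroot, ← Nat.cast_smul_eq_nsmul ℂ, smul_comm,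
      ← neg_smul]; norm_num

variable {D}

lemma HW.nat [FiniteDimensional ℂ M] {v : M} {lam : Dual ℂ H} (h : HW D v lam) (β : PR H b) :
    ∃ n : ℕ, lam (coroot β.1.1) = n := by
  have P : (D.sl2 β).HasPrimitiveVectorWith v (lam (coroot β.1.1)) :=
    ⟨h.ne, h.mem _, h.kill β⟩
  exact P.exists_nat

lemma finrank_refl_le [FiniteDimensional ℂ M] (D : CD H b) (β : PR H b) (μ : Dual ℂ H) (z : ℤ)
    (hz : μ (coroot β.1.1) = z) :
    Module.finrank ℂ (ws H M μ) ≤ Module.finrank ℂ (ws H M (μ - μ (coroot β.1.1) • rt H β)) := by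
  have hf : ∀ h : H, ⁅(h : 𝔤), ((nrm H β.1 : ℂ) / 2) • D.f β⁆ =
      (-rt H β) h • (((nrm H β.1 : ℂ) / 2) • D.f β) := by
    intro h; rw [lie_smul, D.hf, smul_comm]
  rcases Int.eq_nat_or_neg z with ⟨n, rfl | rfl⟩
  · have t := (D.sl2 β).symm
    have t' : IsSl2Triple ((-(coroot β.1.1 : H) : H) : 𝔤) (((nrm H β.1 : ℂ) / 2) • D.f β)
      (D.e β) := t
    have := sl2_finrank_le (M := M) t' (neg_ne_zero.mpr (rt_ne β)) hf
      (by rw [neg_neg]; exact D.he β) (μ := μ) (n := n) (by rw [map_neg, hz]; simp)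
    have hx : μ - μ (coroot β.1.1) • rt H β = μ + (n : ℂ) • (-rt H β) := by
      rw [hz]; simp [sub_eq_add_neg]
    rw [hx]; exact this
  · have := sl2_finrank_le (M := M) (D.sl2 β) (rt_ne β) (D.he β) hf (μ := μ) (n := n)
      (by rw [hz]; simp)
    have hx : μ - μ (coroot β.1.1) • rt H β = μ + (n : ℂ) • (rt H β) := by
      rw [hz]; simp [sub_eq_add_neg]
    rw [hx]; exact this

lemma finrank_refl [FiniteDimensional ℂ M] (D : CD H b) (β : PR H b) (μ : Dual ℂ H) (z : ℤ)
    (hz : μ (coroot β.1.1) = z) :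
    Module.finrank ℂ (ws H M (μ - μ (coroot β.1.1) • rt H β)) = Module.finrank ℂ (ws H M μ) := by
  apply le_antisymm _ (finrank_refl_le D β μ z hz)
  have h1 : (μ - μ (coroot β.1.1) • rt H β) (coroot β.1.1) = ((-z : ℤ) : ℂ) := by
    rw [LinearMap.sub_apply, LinearMap.smul_apply, rt_coroot, hz]; push_cast; simp; ring
  have h2 := finrank_refl_le (M := M) D β _ _ h1
  have hx : (μ - μ (coroot β.1.1) • rt H β) -
      (μ - μ (coroot β.1.1) • rt H β) (coroot β.1.1) • rt H β = μ := by
    rw [h1, hz]; push_cast; rw [neg_smul]; abel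
  rw [hx] at h2
  exact h2

variable (M) in
/-- sum of weight spaces is everything in the irreducible case -/
lemma irr_diag (D : CD H b) [FiniteDimensional ℂ M] [LieModule.IsIrreducible ℂ 𝔤 M] :
    ⨆ μ, ws H M μ = ⊤ := by
  have hnt : Nontrivial M := (LieSubmodule.nontrivial_iff ℂ 𝔤 M).mp inferInstance
  have hst : ∀ x : 𝔤, ∀ w ∈ ⨆ μ, ws H M μ, ⁅x, w⁆ ∈ ⨆ μ, ws H M μ := by
    intro x w hw
    induction hw using Submodule.iSup_induction' with
    | zero => rw [lie_zero]; exact zero_mem _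
    | add y z _ _ hy hz => rw [lie_add]; exact add_mem hy hz
    | mem μ v hv =>
      let T : Submodule ℂ 𝔤 := (⨆ μ, ws H M μ).comap
        ((LieModule.toEnd ℂ 𝔤 M : 𝔤 →ₗ[ℂ] Module.End ℂ M).flip v)
      refine D.induction T ?_ ?_ ?_ x
      · intro y
        change ⁅(y : 𝔤), v⁆ ∈ ⨆ μ, ws H M μ
        rw [hv y]; exact Submodule.smul_mem _ _ (Submodule.mem_iSup_of_mem μ hv)
      · intro β
        exact Submodule.mem_iSup_of_mem _ (shift_ws (D.he β) hv)
      · intro β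
        exact Submodule.mem_iSup_of_mem _ (shift_ws (D.hf β) hv)
  let S : LieSubmodule ℂ 𝔤 M := { (⨆ μ, ws H M μ) with lie_mem := fun hw => hst _ _ hw }
  obtain ⟨χ, hχ⟩ := LieModule.exists_nontrivial_weightSpace_of_isSolvable ℂ H M
  obtain ⟨⟨v, hv⟩, hv0⟩ := exists_ne (0 : LieModule.weightSpace M χ)
  have hvS : v ∈ S := by
    refine Submodule.mem_iSup_of_mem χ ?_
    rw [LieModule.mem_weightSpace] at hv
    exact hv
  have h1 : S ≠ ⊥ := by
    intro h0
    rw [h0] at hvS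
    exact hv0 (Subtype.ext (by simpa using hvS))
  have h2 := (IsSimpleOrder.eq_bot_or_eq_top S).resolve_left h1
  rw [eq_top_iff]
  intro w _
  have : w ∈ S := by rw [h2]; trivial
  exact this

variable (M) in
lemma exists_HW (D : CD H b) [FiniteDimensional ℂ M] [LieModule.IsIrreducible ℂ 𝔤 M] :
    ∃ (lam : Dual ℂ H) (v : M), HW D v lam := by
  have hnt : Nontrivial M := (LieSubmodule.nontrivial_iff ℂ 𝔤 M).mp inferInstance
  have h1 := WellFoundedGT.finite_ne_bot_of_iSupIndep (ws_indep H M)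
  have hne : {μ | ws H M μ ≠ ⊥}.Nonempty := by
    by_contra hc
    rw [Set.not_nonempty_iff_eq_empty, Set.eq_empty_iff_forall_notMem] at hc
    have h2 := irr_diag M D
    have h3 : ∀ μ, ws H M μ = ⊥ := fun μ => by simpa using hc μ
    simp [h3] at h2
  obtain ⟨lam, hl, hmax⟩ := Set.exists_max_image _ (pf b) h1 hne
  obtain ⟨v, hv, hv0⟩ := Submodule.exists_mem_ne_zero_of_ne_bot hl
  refine ⟨lam, v, hv0, hv, fun β => ?_⟩
  by_contra h0
  have h4 := shift_ws (D.he β) hv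
  have h5 := hmax (lam + rt H β) (fun h6 => h0 (by rw [h6] at h4; simpa using h4))
  rw [pf_add] at h5
  have := pf_pos β
  linarith

/-- product of Lie modules -/
instance prodLRM : LieRingModule 𝔤 (M × N) where
  bracket x p := (⁅x, p.1⁆, ⁅x, p.2⁆)
  add_lie x y p := by ext <;> simp
  lie_add x p q := by ext <;> simp
  leibniz_lie x y p := by ext <;> simp

lemma prod_lie (x : 𝔤) (p : M × N) : ⁅x, p⁆ = (⁅x, p.1⁆, ⁅x, p.2⁆) := rfl

instance prodLM : LieModule ℂ 𝔤 (M × N) where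
  smul_lie c x p := by ext <;> simp [prod_lie]
  lie_smul c x p := by ext <;> simp [prod_lie]

lemma HW.prod {v : M} {w : N} {lam : Dual ℂ H} (hv : HW D v lam) (hw : HW D w lam) :
    HW D (v, w) lam where
  ne := fun h => hv.ne (congrArg Prod.fst h)
  mem := fun h => by rw [prod_lie, hv.mem, hw.mem]; rfl
  kill := fun β => by rw [prod_lie, hv.kill, hw.kill]; rfl

theorem HW.iso [LieModule.IsIrreducible ℂ 𝔤 M] [LieModule.IsIrreducible ℂ 𝔤 N]
    {v : M} {w : N} {lam : Dual ℂ H} (hv : HW D v lam) (hw : HW D w lam) :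
    Nonempty (M ≃ₗ⁅ℂ,𝔤⁆ N) := by
  have hp := hv.prod hw
  let p1 : hp.sub →ₗ[ℂ] M := LinearMap.fst ℂ M N ∘ₗ (hp.sub : Submodule ℂ (M × N)).subtype
  let p2 : hp.sub →ₗ[ℂ] N := LinearMap.snd ℂ M N ∘ₗ (hp.sub : Submodule ℂ (M × N)).subtype
  have s1 : Function.Surjective p1 := by
    intro m
    have : gen D v ≤ (gen D (v, w)).map (LinearMap.fst ℂ M N) := by
      apply gen_le
      · exact ⟨(v, w), mem_gen _, rfl⟩
      · rintro β _ ⟨q, hq, rfl⟩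
        exact ⟨⁅D.f β, q⁆, f_gen _ β hq, rfl⟩
    rw [hv.gen_eq_top] at this
    obtain ⟨q, hq, rfl⟩ := this (Submodule.mem_top : m ∈ ⊤)
    exact ⟨⟨q, hq⟩, rfl⟩
  have s2 : Function.Surjective p2 := by
    intro m
    have : gen D w ≤ (gen D (v, w)).map (LinearMap.snd ℂ M N) := by
      apply gen_le
      · exact ⟨(v, w), mem_gen _, rfl⟩
      · rintro β _ ⟨q, hq, rfl⟩
        exact ⟨⁅D.f β, q⁆, f_gen _ β hq, rfl⟩
    rw [hw.gen_eq_top] at this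
    obtain ⟨q, hq, rfl⟩ := this (Submodule.mem_top : m ∈ ⊤)
    exact ⟨⟨q, hq⟩, rfl⟩
  have i1 : Function.Injective p1 := by
    let S : LieSubmodule ℂ 𝔤 N :=
      { (gen D (v, w)).comap (LinearMap.inr ℂ M N) with
        lie_mem := fun {x m} hm => by
          have h1 : ⁅x, ((0, m) : M × N)⁆ ∈ gen D (v, w) := hp.lie_gen hm x
          rw [prod_lie, lie_zero] at h1
          exact h1 }
    have hS : S = ⊥ := by
      refine (IsSimpleOrder.eq_bot_or_eq_top S).resolve_right fun h0 => ?_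
      have h1 : w ∈ S := by rw [h0]; trivial
      have h2 : ((0, w) : M × N) ∈ gen D (v, w) := h1
      obtain ⟨c, hc⟩ := hp.gen_top h2 (fun h => by rw [prod_lie, lie_zero, hw.mem]; simp)
      have h3 : (0 : M) = c • v := congrArg Prod.fst hc
      have h4 : w = c • w := congrArg Prod.snd hc
      have h5 : c = 0 := (smul_eq_zero.mp h3.symm).resolve_right hv.ne
      rw [h5, zero_smul] at h4
      exact hw.ne h4
    rw [← LinearMap.ker_eq_bot, LinearMap.ker_eq_bot']
    rintro ⟨⟨x, y⟩, hq⟩ h0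
    have hx : x = 0 := h0
    subst hx
    have h1 : y ∈ S := hq
    rw [hS] at h1
    have h2 : y = 0 := by simpa using h1
    subst h2
    rfl
  have i2 : Function.Injective p2 := by
    let S : LieSubmodule ℂ 𝔤 M :=
      { (gen D (v, w)).comap (LinearMap.inl ℂ M N) with
        lie_mem := fun {x m} hm => by
          have h1 : ⁅x, ((m, 0) : M × N)⁆ ∈ gen D (v, w) := hp.lie_gen hm x
          rw [prod_lie, lie_zero] at h1
          exact h1 }
    have hS : S = ⊥ := by
      refine (IsSimpleOrder.eq_bot_or_eq_top S).resolve_right fun h0 => ?_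
      have h1 : v ∈ S := by rw [h0]; trivial
      have h2 : ((v, 0) : M × N) ∈ gen D (v, w) := h1
      obtain ⟨c, hc⟩ := hp.gen_top h2 (fun h => by rw [prod_lie, lie_zero, hv.mem]; simp)
      have h3 : (0 : N) = c • w := congrArg Prod.snd hc
      have h4 : v = c • v := congrArg Prod.fst hc
      have h5 : c = 0 := (smul_eq_zero.mp h3.symm).resolve_right hw.ne
      rw [h5, zero_smul] at h4
      exact hv.ne h4
    rw [← LinearMap.ker_eq_bot, LinearMap.ker_eq_bot']
    rintro ⟨⟨x, y⟩, hq⟩ h0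
    have hx : y = 0 := h0
    subst hx
    have h1 : x ∈ S := hq
    rw [hS] at h1
    have h2 : x = 0 := by simpa using h1
    subst h2
    rfl
  let e1 := LinearEquiv.ofBijective p1 ⟨i1, s1⟩
  let e2 := LinearEquiv.ofBijective p2 ⟨i2, s2⟩
  have l1 : ∀ (x : 𝔤) (q : hp.sub), e1 ⁅x, q⁆ = ⁅x, e1 q⁆ := fun _ _ => rfl
  have l2 : ∀ (x : 𝔤) (q : hp.sub), e2 ⁅x, q⁆ = ⁅x, e2 q⁆ := fun _ _ => rfl
  have l3 : ∀ (x : 𝔤) (m : M), (e1.symm.trans e2) ⁅x, m⁆ = ⁅x, (e1.symm.trans e2) m⁆ := by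
    intro x m
    rw [LinearEquiv.trans_apply, LinearEquiv.trans_apply, ← l2]
    congr 1
    apply e1.injective
    rw [l1, LinearEquiv.apply_symm_apply, LinearEquiv.apply_symm_apply]
  exact ⟨{ (e1.symm.trans e2) with map_lie' := fun {x m} => l3 x m }⟩

/-- nontrivial modules have nonzero highest weight -/
lemma HW.ne_zero [FiniteDimensional ℂ M] [LieModule.IsIrreducible ℂ 𝔤 M]
    (hnt : ¬ LieModule.IsTrivial 𝔤 M) {v : M} {lam : Dual ℂ H} (h : HW D v lam) : lam ≠ 0 := by
  rintro rfl
  apply hnt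
  have hk : ∀ x : 𝔤, ⁅x, v⁆ = 0 := by
    intro x
    let T : Submodule ℂ 𝔤 := LinearMap.ker
        ((LieModule.toEnd ℂ 𝔤 M : 𝔤 →ₗ[ℂ] Module.End ℂ M).flip v)
    refine D.induction T ?_ ?_ ?_ x
    · intro y
      change ⁅(y : 𝔤), v⁆ = 0
      rw [h.mem y]; simp
    · intro β
      exact h.kill β
    · intro β
      change ⁅D.f β, v⁆ = 0
      have P : (D.sl2 β).HasPrimitiveVectorWith v (0 : ℂ) :=
        ⟨h.ne, by rw [h.mem]; rfl, h.kill β⟩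
      have h1 := P.pow_toEnd_f_eq_zero_of_eq_nat (n := 0) (by simp)
      rw [zero_add, pow_one, LieModule.toEnd_apply_apply, smul_lie] at h1
      refine (smul_eq_zero.mp h1).resolve_left ?_
      have := (nrm_pos H β.1).ne'
      simpa using this
  have h2 : gen D v ≤ Submodule.span ℂ {v} := by
    apply gen_le
    · exact Submodule.mem_span_singleton_self v
    · intro β w hw
      obtain ⟨c, rfl⟩ := Submodule.mem_span_singleton.mp hw
      rw [lie_smul, hk, smul_zero]; exact zero_mem _
  rw [h.gen_eq_top] at h2
  refine ⟨fun x m => ?_⟩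
  obtain ⟨c, rfl⟩ := Submodule.mem_span_singleton.mp (h2 (Submodule.mem_top : m ∈ ⊤))
  rw [lie_smul, hk, smul_zero]

end irr
end RajanAux

set_option linter.unusedSectionVars false
namespace RajanAux
open Finset LieAlgebra LieAlgebra.IsKilling Module
open scoped TensorProduct

section trace
variable {𝔤 : Type} [LieRing 𝔤] [LieAlgebra ℂ 𝔤] {H : LieSubalgebra ℂ 𝔤}
  {M : Type} [AddCommGroup M] [Module ℂ M] [LieRingModule 𝔤 M] [LieModule ℂ 𝔤 M]

lemma repr_lie_lie {κ : Type} [Fintype κ] (bs : Basis κ ℂ M) (x y : 𝔤) (k : κ) :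
    bs.repr ⁅x, ⁅y, bs k⁆⁆ k = ∑ l, bs.repr ⁅y, bs k⁆ l * bs.repr ⁅x, bs l⁆ k := by
  conv_lhs => rw [← bs.sum_repr ⁅y, bs k⁆]
  rw [lie_sum, map_sum, Finsupp.finsetSum_apply]
  refine Finset.sum_congr rfl fun l _ => ?_
  rw [lie_smul, map_smul, Finsupp.smul_apply, smul_eq_mul]

lemma trace_swap {κ : Type} [Fintype κ] {bs : Basis κ ℂ M} {w : κ → Dual ℂ H} (hb : WB H M bs w)
    {x y : 𝔤} {ν : Dual ℂ H} (hx : ∀ h : H, ⁅(h : 𝔤), x⁆ = ν h • x) :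
    ee (-ν) * ∑ k, (bs.repr ⁅x, ⁅y, bs k⁆⁆ k) • ee (w k) =
      ∑ k, (bs.repr ⁅y, ⁅x, bs k⁆⁆ k) • ee (w k) := by
  simp only [repr_lie_lie, Finset.sum_smul, Finset.mul_sum]
  rw [Finset.sum_comm]
  refine Finset.sum_congr rfl fun l _ => Finset.sum_congr rfl fun k _ => ?_
  by_cases hk : w k = w l + ν
  · rw [mul_smul_comm, ee_mul, hk, mul_comm (bs.repr ⁅x, bs l⁆ k)]
    congr 2
    abel
  · rw [hb.repr_eq_zero (shift_ws hx (hb l)) hk]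
    simp

end trace

section cas
variable {𝔤 : Type} [LieRing 𝔤] [LieAlgebra ℂ 𝔤] [FiniteDimensional ℂ 𝔤] [IsKilling ℂ 𝔤]
  {H : LieSubalgebra ℂ 𝔤} [H.IsCartanSubalgebra] {b : (rootSystem H).Base} {D : CD H b}
  {M : Type} [AddCommGroup M] [Module ℂ M] [LieRingModule 𝔤 M] [LieModule ℂ 𝔤 M]

variable (D) in
/-- first half of the dual bases -/
noncomputable def ca : Fin (Module.finrank ℂ H) ⊕ (PR H b ⊕ PR H b) → 𝔤 :=
  Sum.elim (fun i => (tt H ((finBasis ℂ H).coord i) : 𝔤)) (Sum.elim D.e D.f)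

variable (D) in
/-- second half of the dual bases -/
noncomputable def cb : Fin (Module.finrank ℂ H) ⊕ (PR H b ⊕ PR H b) → 𝔤 :=
  Sum.elim (fun i => (finBasis ℂ H i : 𝔤)) (Sum.elim D.f D.e)

open scoped Classical in
lemma cab (y : 𝔤) : ∑ i, killingForm ℂ 𝔤 (ca D i) y • cb D i = y := by
  let φ : 𝔤 →ₗ[ℂ] 𝔤 := ∑ i, (killingForm ℂ 𝔤 (ca D i)).smulRight (cb D i)
  have hφ : ∀ y, φ y = ∑ i, killingForm ℂ 𝔤 (ca D i) y • cb D i := by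
    intro y; simp [φ]
  have hc : ∀ x y, killingForm ℂ 𝔤 x y = killingForm ℂ 𝔤 y x := fun x y =>
    LieModule.traceForm_comm ℂ 𝔤 𝔤 x y
  rw [← hφ]
  refine D.induction (LinearMap.eqLocus φ LinearMap.id) ?_ ?_ ?_ y
  · intro h
    change φ h = h
    rw [hφ, Fintype.sum_sum_type, Fintype.sum_sum_type]
    simp only [ca, cb, Sum.elim_inl, Sum.elim_inr]
    have h1 : ∀ i, killingForm ℂ 𝔤 (tt H ((finBasis ℂ H).coord i) : 𝔤) h
        = (finBasis ℂ H).repr h i := fun i => traceForm_tt H _ h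
    simp only [h1, hc _ (h : 𝔤), D.khe, D.khf, zero_smul, Finset.sum_const_zero, add_zero]
    have h2 := congrArg (H.toSubmodule.subtype) ((finBasis ℂ H).sum_repr h)
    rw [map_sum] at h2
    exact h2
  · intro β
    change φ (D.e β) = D.e β
    rw [hφ, Fintype.sum_sum_type, Fintype.sum_sum_type]
    simp only [ca, cb, Sum.elim_inl, Sum.elim_inr, D.khe, D.kee, zero_smul,
      Finset.sum_const_zero, zero_add]
    rw [Finset.sum_eq_single β]
    · rw [hc, D.kef, one_smul]
    · intro γ _ h; rw [hc, D.kef' _ _ h.symm, zero_smul]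
    · simp
  · intro β
    change φ (D.f β) = D.f β
    rw [hφ, Fintype.sum_sum_type, Fintype.sum_sum_type]
    simp only [ca, cb, Sum.elim_inl, Sum.elim_inr, D.khf, D.kff, zero_smul,
      Finset.sum_const_zero, zero_add, add_zero]
    rw [Finset.sum_eq_single β]
    · rw [D.kef, one_smul]
    · intro γ _ h; rw [D.kef' _ _ h, zero_smul]
    · simp

open scoped Classical in
lemma cas_ws {μ : Dual ℂ H} {u : M} (hu : u ∈ ws H M μ) :
    ∑ i, ⁅ca D i, ⁅cb D i, u⁆⁆ = dB H μ μ • u +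
      ∑ β, (⁅D.e β, ⁅D.f β, u⁆⁆ + ⁅D.f β, ⁅D.e β, u⁆⁆) := by
  rw [Fintype.sum_sum_type, Fintype.sum_sum_type, Finset.sum_add_distrib]
  simp only [ca, cb, Sum.elim_inl, Sum.elim_inr]
  congr 1
  have h1 : ∀ i, ⁅(tt H ((finBasis ℂ H).coord i) : 𝔤), ⁅(finBasis ℂ H i : 𝔤), u⁆⁆ =
      (μ (finBasis ℂ H i) * dB H ((finBasis ℂ H).coord i) μ) • u := by
    intro i
    rw [hu, lie_smul, hu, smul_smul, dB_symm, dB_apply]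
  simp only [h1]
  rw [← Finset.sum_smul]
  congr 1
  have h2 := congrArg (fun x => dB H x μ) ((finBasis ℂ H).sum_dual_apply_smul_coord μ)
  simp only [map_sum, LinearMap.sum_apply, map_smul, LinearMap.smul_apply, smul_eq_mul] at h2
  exact h2

open scoped Classical in
lemma HW.cas_scalar {v : M} {lam : Dual ℂ H} (h : HW D v lam) :
    ∑ i, ⁅ca D i, ⁅cb D i, v⁆⁆ = (dB H lam lam + 2 * dB H lam (rdOf H b).ρ) • v := by
  rw [cas_ws h.mem, add_smul]
  congr 1
  have h1 : ∀ β, ⁅D.e β, ⁅D.f β, v⁆⁆ + ⁅D.f β, ⁅D.e β, v⁆⁆ = (dB H lam (rt H β)) • v := by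
    intro β
    rw [h.kill, lie_zero, add_zero, leibniz_lie, h.kill, lie_zero, add_zero, D.hef, h.mem, dB_apply]
  simp only [h1]
  rw [← Finset.sum_smul]
  congr 1
  unfold RD.ρ
  rw [map_smul, smul_eq_mul, map_sum, ← mul_assoc, mul_inv_cancel₀ two_ne_zero, one_mul]
  rfl

open scoped Classical in
lemma HW.cas_all [LieModule.IsIrreducible ℂ 𝔤 M] {v : M} {lam : Dual ℂ H} (h : HW D v lam)
    (u : M) :
    ∑ i, ⁅ca D i, ⁅cb D i, u⁆⁆ = (dB H lam lam + 2 * dB H lam (rdOf H b).ρ) • u := by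
  set c := dB H lam lam + 2 * dB H lam (rdOf H b).ρ with hc
  let S : LieSubmodule ℂ 𝔤 M :=
    { carrier := {u | ∑ i, ⁅ca D i, ⁅cb D i, u⁆⁆ = c • u}
      add_mem' := fun {x y} hx hy => by
        simp only [Set.mem_ofPred_eq, lie_add, Finset.sum_add_distrib, smul_add] at *
        rw [hx, hy]
      zero_mem' := by simp
      smul_mem' := fun a x hx => by
        simp only [Set.mem_ofPred_eq, lie_smul, ← Finset.smul_sum] at *
        rw [hx, smul_comm]
      lie_mem := fun {x m} hm => by
        have hm' : ∑ i, ⁅ca D i, ⁅cb D i, m⁆⁆ = c • m := hm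
        change ∑ i, ⁅ca D i, ⁅cb D i, ⁅x, m⁆⁆⁆ = c • ⁅x, m⁆
        rw [← cas_comm (ca D) (cb D) cab x m, hm', lie_smul] }
  have hv : v ∈ S := h.cas_scalar
  have hS : S ≠ ⊥ := by
    intro h0
    rw [h0] at hv
    exact h.ne (by simpa using hv)
  have h2 := (IsSimpleOrder.eq_bot_or_eq_top S).resolve_left hS
  have : u ∈ S := by rw [h2]; trivial
  exact this

open scoped Classical in
lemma cone_Q {x : Dual ℂ H} (hx : x ∈ cone b) :
    ∃ k : b.support → ℕ, x = (rdOf H b).Q (fun i => (k i : ℤ)) := by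
  induction hx using AddSubmonoid.closure_induction with
  | mem x hx =>
    obtain ⟨β, rfl⟩ := hx
    obtain ⟨k, hk⟩ := (rdOf H b).pos β
    refine ⟨k, ?_⟩
    change (rdOf H b).root β = _
    rw [hk]
    simp [RD.Q, RD.α]
  | zero => exact ⟨0, by simp [RD.Q]⟩
  | add x y _ _ hx hy =>
    obtain ⟨k, rfl⟩ := hx
    obtain ⟨l, rfl⟩ := hy
    refine ⟨k + l, ?_⟩
    simp [RD.Q, add_smul, Finset.sum_add_distrib]

open scoped Classical in
theorem HW.isChar [FiniteDimensional ℂ M] [LieModule.IsIrreducible ℂ 𝔤 M] {v : M} {lam : Dual ℂ H}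
    (h : HW D v lam) : (rdOf H b).IsChar lam (ch H M) := by
  have hsupp : ∀ x, (ch H M).coeff x ≠ 0 →
      ∃ k : b.support → ℕ, x = lam - (rdOf H b).Q (fun i => (k i : ℤ)) := by
    intro x hx
    obtain ⟨y, hy, rfl⟩ := h.supp (μ := x) (fun h0 => hx (by rw [ch_coeff, h0]; simp))
    obtain ⟨k, rfl⟩ := cone_Q hy
    exact ⟨k, rfl⟩
  have hdom : ∀ i, ∃ n : ℕ, (rdOf H b).cov i lam = n := fun i => h.nat ((rdOf H b).simple i)
  refine ⟨hsupp, by rw [ch_coeff, h.finrank_top]; simp, ?_, hdom, ?_⟩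
  · have hcint : ∀ i x, (ch H M).coeff x ≠ 0 → ∃ z : ℤ, (rdOf H b).cov i x = z := by
      intro i x hx
      obtain ⟨k, rfl⟩ := hsupp x hx
      obtain ⟨n, hn⟩ := hdom i
      rw [map_sub, hn, RD.cov_Q]
      exact ⟨(n : ℤ) - ∑ j, (rdOf H b).A i j * (k j : ℤ), by rw [Int.cast_sub, Int.cast_natCast]⟩
    intro i x
    by_cases hz : ∃ z : ℤ, (rdOf H b).cov i x = z
    · obtain ⟨z, hz⟩ := hz
      rw [ch_coeff, ch_coeff]
      congr 1
      exact finrank_refl (M := M) D ((rdOf H b).simple i) x z hz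
    · have h1 : (ch H M).coeff x = 0 := by
        by_contra h0; exact hz (hcint i x h0)
      have h2 : (ch H M).coeff ((rdOf H b).s i x) = 0 := by
        by_contra h0
        obtain ⟨z, hz'⟩ := hcint i _ h0
        apply hz
        rw [RD.s_apply, map_sub, map_smul, smul_eq_mul, RD.α, (rdOf H b).hA, (rdOf H b).two] at hz'
        refine ⟨-z, ?_⟩
        push_cast at hz' ⊢
        linear_combination -hz'
      rw [h1, h2]
  · obtain ⟨κ, _, bs, w, hb⟩ := exists_WB H M (irr_diag M D)
    have hχ := hb.ch
    have hwm : ∀ c : Dual ℂ H → ℂ, wm c (ch H M) = ∑ k, c (w k) • ee (w k) := by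
      intro c
      rw [hχ]
      simp only [← wm_ee]
      induction (univ : Finset κ) using Finset.induction_on with
      | empty => simp [wm_zero]
      | insert a s ha ih => rw [Finset.sum_insert ha, Finset.sum_insert ha, wm_add, ih]
    refine ⟨fun β => ∑ k, (bs.repr ⁅D.e β, ⁅D.f β, bs k⁆⁆ k) • ee (w k), ?_, ?_⟩
    · intro β
      rw [sub_mul, one_mul, hwm]
      change _ - ee (-rt H β) * _ = _
      rw [trace_swap hb (D.he β), ← Finset.sum_sub_distrib]
      refine Finset.sum_congr rfl fun k _ => ?_
      rw [← sub_smul]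
      congr 1
      rw [← Finsupp.sub_apply, ← map_sub, ← lie_lie, D.hef, hb k, map_smul, Finsupp.smul_apply,
        Basis.repr_self, Finsupp.single_eq_same, smul_eq_mul, mul_one, ← dB_apply, dB_symm]
      rfl
    · have h1 : ∀ β, (1 + ee (-(rdOf H b).root β)) *
          ∑ k, (bs.repr ⁅D.e β, ⁅D.f β, bs k⁆⁆ k) • ee (w k) =
          ∑ k, (bs.repr (⁅D.e β, ⁅D.f β, bs k⁆⁆ + ⁅D.f β, ⁅D.e β, bs k⁆⁆) k) • ee (w k) := by
        intro β
        rw [add_mul, one_mul]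
        change _ + ee (-rt H β) * _ = _
        rw [trace_swap hb (D.he β), ← Finset.sum_add_distrib]
        refine Finset.sum_congr rfl fun k _ => ?_
        rw [← add_smul, map_add, Finsupp.add_apply]
      simp only [h1]
      unfold RD.Lop
      rw [hwm, Finset.sum_comm, ← Finset.sum_add_distrib]
      rw [hχ, Finset.smul_sum]
      refine Finset.sum_congr rfl fun k _ => ?_
      rw [← Finset.sum_smul, ← add_smul]
      congr 1
      have h2 := h.cas_all (bs k)
      rw [cas_ws (hb k)] at h2
      have h3 := congrArg (fun u => bs.repr u k) h2
      simp only [map_add, map_smul, map_sum, Finsupp.add_apply, Finsupp.smul_apply,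
        Finsupp.finsetSum_apply, Basis.repr_self, Finsupp.single_eq_same, smul_eq_mul,
        mul_one] at h3 ⊢
      exact h3

end cas
end RajanAux

namespace RajanAux
open Finset LieAlgebra LieAlgebra.IsKilling Module
open scoped TensorProduct

section fin
variable {𝔤 : Type} [LieRing 𝔤] [LieAlgebra ℂ 𝔤] [FiniteDimensional ℂ 𝔤] [IsKilling ℂ 𝔤]
  {H : LieSubalgebra ℂ 𝔤} [H.IsCartanSubalgebra] {b : (rootSystem H).Base} (D : CD H b)

/-- the character of the irreducible module with given highest weight -/
noncomputable def chw (lam : Dual ℂ H) : GA (Dual ℂ H) :=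
  Classical.epsilon fun χ => ∃ (N : LieModuleBundle 𝔤) (_ : LieModule.IsIrreducible ℂ 𝔤 N.carrier)
    (_ : FiniteDimensional ℂ N.carrier) (v : N.carrier), HW D v lam ∧ χ = ch H N.carrier

lemma chw_eq (N : LieModuleBundle 𝔤) (i1 : LieModule.IsIrreducible ℂ 𝔤 N.carrier)
    (i2 : FiniteDimensional ℂ N.carrier) (v : N.carrier) (lam : Dual ℂ H) (h : HW D v lam) :
    chw D lam = ch H N.carrier := by
  have h1 : ∃ χ, ∃ (N : LieModuleBundle 𝔤) (_ : LieModule.IsIrreducible ℂ 𝔤 N.carrier)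
    (_ : FiniteDimensional ℂ N.carrier) (v : N.carrier), HW D v lam ∧ χ = ch H N.carrier :=
    ⟨_, N, i1, i2, v, h, rfl⟩
  obtain ⟨N', i1', i2', v', h', e⟩ := Classical.epsilon_spec h1
  have e' : chw D lam = ch H N'.carrier := e
  rw [e']
  obtain ⟨φ⟩ := h'.iso h
  exact ch_congr φ

lemma ch_tensorFamily (m : ℕ) : ∀ (V : Fin (m + 1) → LieModuleBundle 𝔤)
    (_ : ∀ i, LieModule.IsIrreducible ℂ 𝔤 (V i).carrier)
    (_ : ∀ i, FiniteDimensional ℂ (V i).carrier)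
    (lam : Fin (m + 1) → Dual ℂ H) (_ : ∀ i, ∃ v : (V i).carrier, HW D v (lam i)),
    (⨆ μ, ws H (tensorFamily m V).carrier μ = ⊤) ∧
    ∃ (_ : FiniteDimensional ℂ (tensorFamily m V).carrier),
      ch H (tensorFamily m V).carrier = ∏ i, chw D (lam i) := by
  induction m with
  | zero =>
    intro V i1 i2 lam hl
    obtain ⟨v, hv⟩ := hl 0
    have := i1 0
    have := i2 0
    have h1 := irr_diag (V 0).carrier D
    have h2 : ch H (V 0).carrier = ∏ i, chw D (lam i) := by
      have h3 : ∏ i : Fin 1, chw D (lam i) = chw D (lam 0) := Fin.prod_univ_one _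
      exact (chw_eq D (V 0) (i1 0) (i2 0) v _ hv).symm.trans h3.symm
    exact ⟨h1, i2 0, h2⟩
  | succ m ih =>
    intro V i1 i2 lam hl
    obtain ⟨h1, h2, h3⟩ := ih (fun i => V i.castSucc) (fun i => i1 _) (fun i => i2 _)
      (fun i => lam i.castSucc) (fun i => hl _)
    obtain ⟨v, hv⟩ := hl (Fin.last (m + 1))
    have := i1 (Fin.last (m + 1))
    have := i2 (Fin.last (m + 1))
    have h4 := irr_diag (V (Fin.last (m + 1))).carrier D
    have h5 : FiniteDimensional ℂ ((tensorFamily m fun i => V i.castSucc).carrier ⊗[ℂ]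
      (V (Fin.last (m + 1))).carrier) := inferInstance
    refine ⟨diag_tensor h1 h4, h5, ?_⟩
    rw [Fin.prod_univ_castSucc, ← h3, chw_eq D _ (i1 _) (i2 _) v _ hv]
    exact ch_tensor h1 h4

lemma exists_perm_of_map_eq {κ α : Type} [Fintype κ] (f g : κ → α)
    (h : (Finset.univ : Finset κ).val.map f = (Finset.univ : Finset κ).val.map g) :
    ∃ σ : Equiv.Perm κ, f = g ∘ σ := by
  classical
  have hc : ∀ (f : κ → α) c, Fintype.card {i // f i = c} =
      Multiset.count c ((Finset.univ : Finset κ).val.map f) := by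
    intro f c
    rw [Multiset.count_map, Fintype.card_subtype, Finset.card, Finset.filter_val]
    congr 2
    ext i
    exact eq_comm
  have h1 : ∀ c, Nonempty ({i // f i = c} ≃ {i // g i = c}) := by
    intro c
    apply Fintype.card_eq.mp
    rw [hc, hc, h]
  let e : ∀ c, {i // f i = c} ≃ {i // g i = c} := fun c => (h1 c).some
  refine ⟨(Equiv.sigmaFiberEquiv f).symm.trans
    ((Equiv.sigmaCongrRight e).trans (Equiv.sigmaFiberEquiv g)), ?_⟩
  funext i
  exact ((e (f i)) ⟨i, rfl⟩).2.symm

end fin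
end RajanAux

open RajanAux in
theorem unique_tensor_decomposition_simple_lie_algebra
    (𝔤 : Type) [LieRing 𝔤] [LieAlgebra ℂ 𝔤] [FiniteDimensional ℂ 𝔤] [LieAlgebra.IsSimple ℂ 𝔤]
    (m n : ℕ) (V : Fin (m + 1) → LieModuleBundle 𝔤) (W : Fin (n + 1) → LieModuleBundle 𝔤)
    (hVnontriv : ∀ i, ¬ LieModule.IsTrivial 𝔤 (V i).carrier)
    (hVirr : ∀ i, LieModule.IsIrreducible ℂ 𝔤 (V i).carrier)
    (hVfin : ∀ i, FiniteDimensional ℂ (V i).carrier)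
    (hWnontriv : ∀ j, ¬ LieModule.IsTrivial 𝔤 (W j).carrier)
    (hWirr : ∀ j, LieModule.IsIrreducible ℂ 𝔤 (W j).carrier)
    (hWfin : ∀ j, FiniteDimensional ℂ (W j).carrier)
    (hiso : Nonempty ((tensorFamily m V).carrier ≃ₗ⁅ℂ,𝔤⁆ (tensorFamily n W).carrier)) :
    ∃ h : m = n, ∃ σ : Equiv.Perm (Fin (n + 1)), ∀ i : Fin (n + 1),
      Nonempty ((V (Fin.cast (congrArg (· + 1) h.symm) i)).carrier ≃ₗ⁅ℂ,𝔤⁆ (W (σ i)).carrier) := by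
  classical
  obtain ⟨H, hH⟩ : ∃ H : LieSubalgebra ℂ 𝔤, H.IsCartanSubalgebra := by
    obtain ⟨x, hx⟩ := LieAlgebra.exists_isCartanSubalgebra_engel ℂ 𝔤
    exact ⟨_, hx⟩
  obtain ⟨b⟩ := RootPairing.nonempty_base (P := (LieAlgebra.IsKilling.rootSystem H))
  obtain ⟨D⟩ := exists_CD H b
  have hirr : (LieAlgebra.IsKilling.rootSystem H).IsIrreducible := inferInstance
  have hne' : Nonempty b.support := by
    have : Nontrivial (Module.Dual ℂ H) := hirr.nontrivial
    obtain ⟨x, hx⟩ := exists_ne (0 : Module.Dual ℂ H)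
    by_contra h0
    exact hx ((rdOf H b).cov_inj x fun i => absurd ⟨i⟩ h0)
  have hV : ∀ i, ∃ lam : Module.Dual ℂ H, ∃ v : (V i).carrier, HW D v lam := fun i =>
    have := hVirr i; have := hVfin i; exists_HW (V i).carrier D
  have hW : ∀ i, ∃ lam : Module.Dual ℂ H, ∃ v : (W i).carrier, HW D v lam := fun i =>
    have := hWirr i; have := hWfin i; exists_HW (W i).carrier D
  choose lam hlam using hV
  choose mu hmu using hW
  obtain ⟨-, f1, e1⟩ := ch_tensorFamily D m V hVirr hVfin lam hlam
  obtain ⟨-, f2, e2⟩ := ch_tensorFamily D n W hWirr hWfin mu hmu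
  obtain ⟨φ⟩ := hiso
  have e3 := ch_congr (H := H) φ
  rw [e1, e2] at e3
  have key := (rdOf H b).unique (rd_conn H b) (chw D) (Finset.univ.val.map lam)
    (Finset.univ.val.map mu) (by
      intro l hl
      obtain ⟨i, -, rfl⟩ := Multiset.mem_map.mp hl
      obtain ⟨v, hv⟩ := hlam i
      have := hVirr i
      have := hVfin i
      refine ⟨hv.ne_zero (hVnontriv i), ?_⟩
      rw [chw_eq D _ (hVirr i) (hVfin i) v _ hv]
      exact hv.isChar) (by
      intro l hl
      obtain ⟨i, -, rfl⟩ := Multiset.mem_map.mp hl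
      obtain ⟨v, hv⟩ := hmu i
      have := hWirr i
      have := hWfin i
      refine ⟨hv.ne_zero (hWnontriv i), ?_⟩
      rw [chw_eq D _ (hWirr i) (hWfin i) v _ hv]
      exact hv.isChar) (by
      rw [Multiset.map_map, Multiset.map_map]
      exact e3)
  have hmn : m = n := by
    have := congrArg Multiset.card key
    simpa using this
  subst hmn
  obtain ⟨σ, hσ⟩ := exists_perm_of_map_eq lam mu key
  refine ⟨rfl, σ, fun i => ?_⟩
  obtain ⟨v, hv⟩ := hlam i
  obtain ⟨w, hw⟩ := hmu (σ i)
  have h1 : lam i = mu (σ i) := congrFun hσ i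
  rw [← h1] at hw
  have := hVirr i
  have := hWirr (σ i)
  exact hv.iso hw
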